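/- arXiv:2412.07974 — 2 statements merged into one kernel-verified Lean document; each statement's English description precedes it below -/
import Mathlib

section
/- Let k ≥ 5. There exists n_0 = n_0(k) such that for all n ≥ n_0 the following holds: if F is an intersecting family of k-element subsets of [n] with |F| > |J_3|, then there exist an element i ∈ [n] and a (k−1)-element set K ⊆ [n]∖{i} such that every member of F either contains i or contains K (i.e., F is contained in a family E_l for some l ∈ {0,…,k−1, n−k}). -/
/-- A family is intersecting if any two of its members intersect. -/
def Intersecting (F : Finset (Finset ℕ)) : Prop :=
  ∀ A ∈ F, ∀ B ∈ F, (A ∩ B).Nonempty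

/-- `I_i = [i+1, k+i]`. -/
def Iset (k i : ℕ) : Finset ℕ := Finset.Icc (i + 1) (k + i)

/-- The family `J_i = {I_1, I_i} ∪ {F ∈ C([n],k) : 1 ∈ F, F ∩ I_1 ≠ ∅, F ∩ I_i ≠ ∅}`. -/
def Jfam (n k i : ℕ) : Finset (Finset ℕ) :=
  {Iset k 1, Iset k i} ∪
    (Finset.powersetCard k (Finset.Icc 1 n)).filter
      (fun A => 1 ∈ A ∧ (A ∩ Iset k 1).Nonempty ∧ (A ∩ Iset k i).Nonempty)

open Finset

theorem ch_lower (m j t : ℕ) : m.choose (j+1) + t * m.choose j ≤ (m+t).choose (j+1) := by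
  induction t with
  | zero => simp
  | succ t ih =>
    have h1 : (m+t+1).choose (j+1) = (m+t).choose j + (m+t).choose (j+1) := Nat.choose_succ_succ _ _
    have h2 : m.choose j ≤ (m+t).choose j := Nat.choose_le_choose j (by omega)
    rw [← add_assoc, h1]
    nlinarith

theorem ch_upper (m j t : ℕ) : (m+t).choose (j+1) ≤ m.choose (j+1) + t * (m+t).choose j := by
  induction t with
  | zero => simp
  | succ t ih =>
    have h1 : (m+t+1).choose (j+1) = (m+t).choose j + (m+t).choose (j+1) := Nat.choose_succ_succ _ _
    have h2 : (m+t).choose j ≤ (m+t+1).choose j := Nat.choose_le_choose j (by omega)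
    rw [← add_assoc, h1]
    nlinarith

theorem ch_small (n j D : ℕ) (h : j + D * (j+1) ≤ n) : D * n.choose j ≤ n.choose (j+1) := by
  have h1 := Nat.choose_succ_right_eq n j
  have h2 : D * (j+1) ≤ n - j := by omega
  have h3 : n.choose j * (D * (j+1)) ≤ n.choose j * (n - j) := Nat.mul_le_mul_left _ h2
  have h4 : (D * n.choose j) * (j+1) ≤ n.choose (j+1) * (j+1) := by rw [h1]; linarith
  exact Nat.le_of_mul_le_mul_right h4 (by omega)

theorem ch_mono (n a j : ℕ) (h : 2 * (a + j) + 1 ≤ n) : n.choose a ≤ n.choose (a + j) := by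
  induction j with
  | zero => simp
  | succ j ih =>
    have := ch_small n (a+j) 1 (by omega)
    rw [← add_assoc]
    have := ih (by omega)
    omega

/-- second order difference -/
theorem ch_second (m j : ℕ) :
    2 * (m+2).choose (j+4) + 4 * m.choose (j+2) ≤ (m+4).choose (j+4) + m.choose (j+4) := by
  have e1 : ∀ a b, (a+1).choose (b+1) = a.choose b + a.choose (b+1) := fun a b => Nat.choose_succ_succ a b
  have h1 := e1 (m+3) (j+3)
  have h2 := e1 (m+2) (j+3)
  have h3 := e1 (m+1) (j+3)
  have h4 := e1 (m) (j+3)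
  have h5 := e1 (m+2) (j+2)
  have h6 := e1 (m+1) (j+2)
  have h7 := e1 (m) (j+2)
  have h8 := e1 (m+1) (j+1)
  have h9 := e1 (m) (j+1)
  simp only [add_assoc, Nat.reduceAdd] at *
  omega

section
variable (j m J : ℕ)

theorem J_low (hJ : J + 2 * (m+2).choose (j+4) = 2 + (m+j+7).choose (j+4) + m.choose (j+4)) :
    (m+j+7).choose (j+4) + 4 * m.choose (j+2) + 2 ≤ J + (m+4).choose (j+4) := by
  have := ch_second m j
  omega

theorem A1 (hm : 1000 * (j+5)^4 ≤ m)
    (hJ : J + 2 * (m+2).choose (j+4) = 2 + (m+j+7).choose (j+4) + m.choose (j+4)) :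
    (j+2) * (m+j+6).choose (j+3) + (j+5)^3 * (m+j+5).choose (j+2) ≤ J := by
  have h0 := J_low j m J hJ
  have h1 := ch_lower (m+4) (j+3) (j+3)
  have h2 := ch_upper (m+4) (j+2) (j+4)
  have h3 := ch_small (m+j+8) (j+2) ((j+5)^3 + (j+3)*(j+4)) (by nlinarith [pow_pos (show 0 < j+5 by omega) 3, pow_pos (show 0 < j+5 by omega) 2])
  have e1 : m + 4 + (j+3) = m+j+7 := by omega
  have e2 : m + 4 + (j+4) = m+j+8 := by omega
  have h4 : (m+j+6).choose (j+3) ≤ (m+j+8).choose (j+3) := Nat.choose_le_choose _ (by omega)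
  have h5 : (m+j+5).choose (j+2) ≤ (m+j+8).choose (j+2) := Nat.choose_le_choose _ (by omega)
  rw [e1] at h1
  rw [e2] at h2
  have h6 := Nat.mul_le_mul_left (j+2) h4
  have h7 := Nat.mul_le_mul_left ((j+5)^3) h5
  have h8 := Nat.mul_le_mul_left (j+3) h2
  simp only [add_assoc, Nat.reduceAdd] at *
  nlinarith

theorem A23 (hm : 1000 * (j+5)^4 ≤ m)
    (hJ : J + 2 * (m+2).choose (j+4) = 2 + (m+j+7).choose (j+4) + m.choose (j+4))
    (p b : ℕ) (hp : p ≤ 3) (hb : b ≤ (m+j+8).choose 2) (hpb : 1 ≤ p → b ≤ 2 * (m+j+8)) :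
    (m+j+7).choose (j+4) + p * (m+j+5).choose (j+2) + 8 * (m+j+4).choose (j+1) + b
      ≤ J + (m+4).choose (j+4) := by
  have h0 := J_low j m J hJ
  have hmj : 1000 * (j + 5) ≤ m := by
    have : (j+5)^4 = (j+5) * (j+5)^3 := by ring
    have := pow_pos (show 0 < j+5 by omega) 3
    nlinarith
  have hmj2 : 1000 * ((j + 5) * (j+5)) ≤ m := by
    have : (j+5)^4 = (j+5)*(j+5) * (j+5)^2 := by ring
    have := pow_pos (show 0 < j+5 by omega) 2
    nlinarith
  have h2 := ch_upper m (j+1) (j+8)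
  have h3 := ch_small (m+j+8) (j+1) (10+4*(j+8)) (by nlinarith)
  have e2 : m + (j+8) = m+j+8 := by omega
  rw [e2] at h2
  have h4 : (m+j+5).choose (j+2) ≤ (m+j+8).choose (j+2) := Nat.choose_le_choose _ (by omega)
  have h5 : (m+j+4).choose (j+1) ≤ (m+j+8).choose (j+1) := Nat.choose_le_choose _ (by omega)
  have h6 := ch_mono (m+j+8) 2 j (by omega)
  have h7 := ch_mono (m+j+8) 1 j (by omega)
  rw [Nat.choose_one_right] at h7
  rw [add_comm 2 j] at h6
  rw [add_comm 1 j] at h7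
  simp only [add_assoc, Nat.reduceAdd] at *
  rcases Nat.eq_zero_or_pos p with rfl | hp1
  · nlinarith
  · have := hpb hp1
    have := Nat.mul_le_mul hp h4
    nlinarith

theorem A4 (hm : 1000 * 5^4 ≤ m)
    (hJ : J + 2 * (m+2).choose 4 = 2 + (m+7).choose 4 + m.choose 4) :
    3 * (m+5).choose 3 + (m+5).choose 2 ≤ J := by
  have h0 := J_low 0 m J hJ
  have e1 : ∀ a b, (a+1).choose (b+1) = a.choose b + a.choose (b+1) := fun a b => Nat.choose_succ_succ a b
  have h1 := e1 (m+6) 3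
  have h2 := e1 (m+5) 3
  have h3 := e1 (m+4) 3
  have h4 := e1 (m+5) 2
  have h5 := e1 (m+4) 2
  have h6 := ch_upper m 1 4
  have h7 := ch_small (m+4) 1 16 (by omega)
  simp only [add_assoc, Nat.reduceAdd] at *
  omega
end

theorem card_supersets (X Q : Finset ℕ) (k : ℕ) :
    ((powersetCard k X).filter (fun A => Q ⊆ A)).card ≤ (X.card - Q.card).choose (k - Q.card) := by
  by_cases hQ : Q ⊆ X
  · rw [← card_sdiff_of_subset hQ, ← card_powersetCard]
    apply card_le_card_of_injOn (fun A => A \ Q)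
    · intro A hA
      simp only [coe_filter, mem_powersetCard, Set.mem_ofPred_eq, mem_coe] at hA ⊢
      exact ⟨sdiff_subset_sdiff hA.1.1 (le_refl _), by rw [card_sdiff_of_subset hA.2, hA.1.2]⟩
    · intro A hA B hB h
      simp only [coe_filter, mem_powersetCard, Set.mem_ofPred_eq] at hA hB h
      rw [← sdiff_union_of_subset hA.2, h, sdiff_union_of_subset hB.2]
  · rw [filter_eq_empty_iff.2]
    · simp
    · intro A hA h
      exact hQ (h.trans (mem_powersetCard.1 hA).1)

theorem card_avoid (X U : Finset ℕ) (c k : ℕ) (hk : 1 ≤ k) (hc : c ∈ X) (hU : U ⊆ X.erase c) :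
    ((powersetCard k X).filter (fun A => c ∈ A ∧ ¬ (A ∩ U).Nonempty)).card
      = (X.card - 1 - U.card).choose (k-1) := by
  rw [← card_erase_of_mem hc, ← card_sdiff_of_subset hU, ← card_powersetCard]
  have hcU : c ∉ U := fun h => by simpa using hU h
  refine card_bij' (fun A _ => A.erase c) (fun A _ => insert c A) ?_ ?_ ?_ ?_
  · intro A hA
    simp only [mem_filter, mem_powersetCard, not_nonempty_iff_eq_empty] at hA ⊢
    obtain ⟨⟨h1, h2⟩, h3, h4⟩ := hA
    refine ⟨?_, by rw [card_erase_of_mem h3, h2]⟩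
    intro x hx
    simp only [mem_erase, mem_sdiff] at hx ⊢
    refine ⟨⟨hx.1, h1 hx.2⟩, fun h => ?_⟩
    have : x ∈ A ∩ U := mem_inter.2 ⟨hx.2, h⟩
    simp [h4] at this
  · intro A hA
    simp only [mem_filter, mem_powersetCard, not_nonempty_iff_eq_empty] at hA ⊢
    obtain ⟨h1, h2⟩ := hA
    have hcA : c ∉ A := fun h => by simpa using h1 h
    refine ⟨⟨?_, by rw [card_insert_of_notMem hcA, h2]; omega⟩, by simp, ?_⟩
    · intro x hx
      rcases mem_insert.1 hx with rfl | hx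
      · exact hc
      · have := h1 hx
        simp at this
        exact this.1.2
    · ext x
      simp only [mem_inter, mem_insert, notMem_empty, iff_false]
      rintro ⟨rfl | h, h'⟩
      · exact hcU h'
      · have := h1 h
        simp at this
        exact this.2 h'
  · intro A hA
    simp only [mem_filter] at hA
    exact insert_erase hA.2.1
  · intro A hA
    have h1 := (mem_powersetCard.1 hA).1
    exact erase_insert (fun h => by simpa using h1 h)

theorem card_hit2 (X U V : Finset ℕ) (c k : ℕ) (hk : 1 ≤ k) (hc : c ∈ X) (hU : U ⊆ X.erase c)
    (hV : V ⊆ X.erase c) :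
    ((powersetCard k X).filter (fun A => c ∈ A ∧ (A ∩ U).Nonempty ∧ (A ∩ V).Nonempty)).card
      + (X.card - 1 - U.card).choose (k-1) + (X.card - 1 - V.card).choose (k-1)
      = (X.card - 1).choose (k-1) + (X.card - 1 - (U ∪ V).card).choose (k-1) := by
  have h0 := card_avoid X ∅ c k hk hc (by simp)
  have h1 := card_avoid X U c k hk hc hU
  have h2 := card_avoid X V c k hk hc hV
  have h3 := card_avoid X (U ∪ V) c k hk hc (union_subset hU hV)
  simp only [inter_empty, Finset.not_nonempty_empty, not_false_eq_true, and_true, card_empty, Nat.sub_zero] at h0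
  rw [← h0, ← h1, ← h2, ← h3]
  simp only [card_filter, ← sum_add_distrib]
  apply sum_congr rfl
  intro A _
  have hh : (A ∩ (U ∪ V)).Nonempty ↔ (A ∩ U).Nonempty ∨ (A ∩ V).Nonempty := by
    rw [inter_union_distrib_left, union_nonempty]
  by_cases c ∈ A <;> by_cases (A ∩ U).Nonempty <;> by_cases (A ∩ V).Nonempty <;> simp_all

theorem branch (H : Finset (Finset ℕ)) (r : ℕ) (hr : ∀ e ∈ H, e.card ≤ r)
    (hH : ∀ x, ∃ e ∈ H, x ∉ e) :
    ∃ T : Finset (Finset ℕ), T.card ≤ r^3 ∧ (∀ t ∈ T, t.card = 3) ∧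
      ∀ A : Finset ℕ, (∀ e ∈ H, (A ∩ e).Nonempty) →
        (∃ Q, Q ⊆ A ∧ Q.card = 2 ∧ ∀ e ∈ H, (Q ∩ e).Nonempty) ∨ ∃ t ∈ T, t ⊆ A := by
  classical
  obtain ⟨e0, he0, -⟩ := hH 0
  choose f hf hxf using hH
  -- g x y : an edge avoiding x and y if one exists, else empty
  have hg : ∀ x y, ∃ g : Finset ℕ, g.card ≤ r ∧ x ∉ g ∧ y ∉ g ∧
      ((∀ e ∈ H, (({x, y} : Finset ℕ) ∩ e).Nonempty) ∨ g ∈ H) := by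
    intro x y
    by_cases h : ∀ e ∈ H, (({x, y} : Finset ℕ) ∩ e).Nonempty
    · exact ⟨∅, by simp, by simp, by simp, Or.inl h⟩
    · push Not at h
      obtain ⟨e, he, h⟩ := h
      refine ⟨e, hr e he, ?_, ?_, Or.inr he⟩
      · intro hx
        have : x ∈ ({x, y} : Finset ℕ) ∩ e := by simp [hx]
        simp [h] at this
      · intro hx
        have : y ∈ ({x, y} : Finset ℕ) ∩ e := by simp [hx]
        simp [h] at this
  choose g hgr hgx hgy hgH using hg
  refine ⟨e0.biUnion fun x => (f x).biUnion fun y => (g x y).image fun z => {x, y, z}, ?_, ?_, ?_⟩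
  · have : r^3 = r * (r * r) := by ring
    rw [this]
    refine (card_biUnion_le_card_mul _ _ (r*r) ?_).trans (Nat.mul_le_mul_right _ (hr _ he0))
    intro x _
    refine (card_biUnion_le_card_mul _ _ r ?_).trans (Nat.mul_le_mul_right _ (hr _ (hf x)))
    intro y _
    exact card_image_le.trans (hgr x y)
  · intro t ht
    simp only [mem_biUnion, mem_image] at ht
    obtain ⟨x, hx, y, hy, z, hz, rfl⟩ := ht
    apply card_eq_three.2
    refine ⟨x, y, z, ?_, ?_, ?_, rfl⟩
    · rintro rfl; exact hxf _ hy
    · rintro rfl; exact hgx _ _ hz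
    · rintro rfl; exact hgy _ _ hz
  · intro A hA
    obtain ⟨x, hx⟩ := hA e0 he0
    obtain ⟨y, hy⟩ := hA (f x) (hf x)
    rw [mem_inter] at hx hy
    have hxy : x ≠ y := by rintro rfl; exact hxf _ hy.2
    rcases hgH x y with h | h
    · exact Or.inl ⟨{x,y}, by simp [insert_subset_iff, hx.1, hy.1], card_pair hxy, h⟩
    · obtain ⟨z, hz⟩ := hA _ h
      rw [mem_inter] at hz
      refine Or.inr ⟨{x,y,z}, ?_, by simp [insert_subset_iff, hx.1, hy.1, hz.1]⟩
      simp only [mem_biUnion, mem_image]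
      exact ⟨x, hx.2, y, hy.2, z, hz.2, rfl⟩

/-- two-element covers of `H` inside `X` -/
def covers2 (X : Finset ℕ) (H : Finset (Finset ℕ)) : Finset (Finset ℕ) :=
  (powersetCard 2 X).filter (fun Q => ∀ e ∈ H, (Q ∩ e).Nonempty)

theorem branch_card (X : Finset ℕ) (k : ℕ) (hk : 3 ≤ k) (G H : Finset (Finset ℕ))
    (hG : G ⊆ powersetCard k X) (r : ℕ) (hr : ∀ e ∈ H, e.card ≤ r)
    (hH : ∀ x, ∃ e ∈ H, x ∉ e) (hGH : ∀ A ∈ G, ∀ e ∈ H, (A ∩ e).Nonempty) :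
    G.card ≤ (covers2 X H).card * (X.card - 2).choose (k-2) + r^3 * (X.card - 3).choose (k-3) := by
  classical
  obtain ⟨T, hT, hT3, h⟩ := branch H r hr hH
  have hsub : G ⊆ (covers2 X H).biUnion (fun Q => (powersetCard k X).filter (fun A => Q ⊆ A))
      ∪ T.biUnion (fun Q => (powersetCard k X).filter (fun A => Q ⊆ A)) := by
    intro A hA
    simp only [mem_union, mem_biUnion, mem_filter]
    rcases h A (hGH A hA) with ⟨Q, hQA, hQ2, hQ⟩ | ⟨t, ht, htA⟩
    · refine Or.inl ⟨Q, ?_, hG hA, hQA⟩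
      simp only [covers2, mem_filter, mem_powersetCard]
      exact ⟨⟨hQA.trans (mem_powersetCard.1 (hG hA)).1, hQ2⟩, hQ⟩
    · exact Or.inr ⟨t, ht, hG hA, htA⟩
  refine (card_le_card hsub).trans ((card_union_le _ _).trans (Nat.add_le_add ?_ ?_))
  · apply card_biUnion_le_card_mul
    intro Q hQ
    simp only [covers2, mem_filter, mem_powersetCard] at hQ
    have := card_supersets X Q k
    rwa [hQ.1.2] at this
  · refine (card_biUnion_le_card_mul _ _ ((X.card - 3).choose (k-3)) ?_).trans (Nat.mul_le_mul_right _ hT)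
    intro Q hQ
    have := card_supersets X Q k
    rwa [hT3 Q hQ] at this

theorem exists_maximal_ext (X : Finset ℕ) (k : ℕ) (hk : 1 ≤ k) (F : Finset (Finset ℕ))
    (hF : F ⊆ powersetCard k X) (hi : ∀ A ∈ F, ∀ B ∈ F, (A ∩ B).Nonempty) :
    ∃ G, F ⊆ G ∧ G ⊆ powersetCard k X ∧ (∀ A ∈ G, ∀ B ∈ G, (A ∩ B).Nonempty) ∧
      ∀ A ∈ powersetCard k X, (∀ B ∈ G, (A ∩ B).Nonempty) → A ∈ G := by
  classical
  let S := (powersetCard k X).powerset.filter (fun G => ∀ A ∈ G, ∀ B ∈ G, (A ∩ B).Nonempty)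
  obtain ⟨G, hFG, hG⟩ := Finset.exists_le_maximal S (a := F) (by simp only [S, mem_filter, mem_powerset]; exact ⟨hF, hi⟩)
  have hGS := hG.1
  simp only [S, mem_filter, mem_powerset] at hGS
  refine ⟨G, hFG, hGS.1, hGS.2, ?_⟩
  intro A hA hAB
  have : insert A G ∈ S := by
    simp only [S, mem_filter, mem_powerset]
    refine ⟨insert_subset hA hGS.1, ?_⟩
    intro B hB C hC
    rcases mem_insert.1 hB with hB' | hB' <;> rcases mem_insert.1 hC with hC' | hC'
    · rw [hB', hC', inter_self, ← card_pos, (mem_powersetCard.1 hA).2]; omega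
    · rw [hB']; exact hAB _ hC'
    · rw [hC', inter_comm]; exact hAB _ hB'
    · exact hGS.2 _ hB' _ hC'
  exact hG.2 this (subset_insert _ _) (mem_insert_self _ _)

theorem covers_inter (X : Finset ℕ) (k : ℕ) (hk : 2 ≤ k) (hX : 2 * k ≤ X.card) (G : Finset (Finset ℕ))
    (hi : ∀ A ∈ G, ∀ B ∈ G, (A ∩ B).Nonempty)
    (hm : ∀ A ∈ powersetCard k X, (∀ B ∈ G, (A ∩ B).Nonempty) → A ∈ G) :
    ∀ S ∈ covers2 X G, ∀ T ∈ covers2 X G, (S ∩ T).Nonempty := by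
  intro S hS T hT
  simp only [covers2, mem_filter, mem_powersetCard] at hS hT
  by_contra hST
  rw [not_nonempty_iff_eq_empty, ← disjoint_iff_inter_eq_empty] at hST
  obtain ⟨S', h1, h2, h3⟩ := exists_subsuperset_card_eq (s := S) (t := X \ T) (n := k)
    (subset_sdiff.2 ⟨hS.1.1, hST⟩) (by omega) (by rw [card_sdiff_of_subset hT.1.1]; omega)
  have h2' := subset_sdiff.1 h2
  obtain ⟨T', h4, h5, h6⟩ := exists_subsuperset_card_eq (s := T) (t := X \ S') (n := k)
    (subset_sdiff.2 ⟨hT.1.1, h2'.2.symm⟩) (by omega) (by rw [card_sdiff_of_subset h2'.1]; omega)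
  have h5' := subset_sdiff.1 h5
  have := hi S' (hm S' (mem_powersetCard.2 ⟨h2'.1, h3⟩) fun B hB => (hS.2 B hB).mono (inter_subset_inter_right h1))
    T' (hm T' (mem_powersetCard.2 ⟨h5'.1, h6⟩) fun B hB => (hT.2 B hB).mono (inter_subset_inter_right h4))
  rw [disjoint_iff_inter_eq_empty.1 h5'.2.symm] at this
  simp at this

theorem tri (G : Finset (Finset ℕ)) (h2 : ∀ e ∈ G, e.card = 2)
    (hi : ∀ A ∈ G, ∀ B ∈ G, (A ∩ B).Nonempty) (hx : ∀ x, ∃ e ∈ G, x ∉ e) :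
    ∃ a b c, a ≠ b ∧ b ≠ c ∧ a ≠ c ∧ {a, b} ∈ G ∧ {b, c} ∈ G ∧ {a, c} ∈ G := by
  obtain ⟨e, he, -⟩ := hx 0
  obtain ⟨a, b, hab, rfl⟩ := card_eq_two.1 (h2 e he)
  obtain ⟨f, hf, haf⟩ := hx a
  have hbf : b ∈ f := by
    obtain ⟨x, hx⟩ := hi _ he _ hf
    simp only [mem_inter, mem_insert, mem_singleton] at hx
    rcases hx with ⟨rfl | rfl, h⟩
    · exact absurd h haf
    · exact h
  obtain ⟨c, hc⟩ : ∃ c, c ≠ b ∧ f = {b, c} := by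
    obtain ⟨p, q, hpq, rfl⟩ := card_eq_two.1 (h2 f hf)
    simp only [mem_insert, mem_singleton] at hbf
    rcases hbf with rfl | rfl
    · exact ⟨q, hpq.symm, rfl⟩
    · exact ⟨p, hpq, pair_comm _ _⟩
  obtain ⟨hcb, rfl⟩ := hc
  obtain ⟨g, hg, hbg⟩ := hx b
  have hac : a ≠ c := by rintro rfl; simp at haf
  have hag : a ∈ g := by
    obtain ⟨x, hx⟩ := hi _ he _ hg
    simp only [mem_inter, mem_insert, mem_singleton] at hx
    rcases hx with ⟨rfl | rfl, h⟩
    · exact h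
    · exact absurd h hbg
  have hcg : c ∈ g := by
    obtain ⟨x, hx⟩ := hi _ hf _ hg
    simp only [mem_inter, mem_insert, mem_singleton] at hx
    rcases hx with ⟨rfl | rfl, h⟩
    · exact absurd h hbg
    · exact h
  have : {a, c} = g := eq_of_subset_of_card_le (by simp [insert_subset_iff, hag, hcg])
    (by rw [h2 g hg, card_pair hac])
  exact ⟨a, b, c, hab, hcb.symm, hac, he, hf, this ▸ hg⟩

theorem two_of_three (S : Finset ℕ) (a b c : ℕ) (h1 : (S ∩ {a,b}).Nonempty)
    (h2 : (S ∩ {b,c}).Nonempty) (h3 : (S ∩ {a,c}).Nonempty) :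
    {a,b} ⊆ S ∨ {b,c} ⊆ S ∨ {a,c} ⊆ S := by
  obtain ⟨x, hx⟩ := h1
  obtain ⟨y, hy⟩ := h2
  obtain ⟨z, hz⟩ := h3
  simp only [mem_inter, mem_insert, mem_singleton, insert_subset_iff, singleton_subset_iff] at *
  grind

/-- covers of a triangle -/
theorem covers_tri (X : Finset ℕ) (H : Finset (Finset ℕ)) (a b c : ℕ) (hab : a ≠ b) (hbc : b ≠ c)
    (hac : a ≠ c) (h1 : {a,b} ∈ H) (h2 : {b,c} ∈ H) (h3 : {a,c} ∈ H) : (covers2 X H).card ≤ 3 := by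
  have : covers2 X H ⊆ {{a,b},{b,c},{a,c}} := by
    intro S hS
    simp only [covers2, mem_filter, mem_powersetCard] at hS
    have hS2 := hS.1.2
    simp only [mem_insert, mem_singleton]
    rcases two_of_three S a b c (hS.2 _ h1) (hS.2 _ h2) (hS.2 _ h3) with h | h | h
    · exact Or.inl (eq_of_subset_of_card_le h (by rw [hS2, card_pair hab])).symm
    · exact Or.inr (Or.inl (eq_of_subset_of_card_le h (by rw [hS2, card_pair hbc])).symm)
    · exact Or.inr (Or.inr (eq_of_subset_of_card_le h (by rw [hS2, card_pair hac])).symm)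
  exact (card_le_card this).trans card_le_three

theorem covers_disj (X : Finset ℕ) (H : Finset (Finset ℕ)) (h2 : ∀ e ∈ H, e.card = 2)
    (e f g : Finset ℕ) (he : e ∈ H) (hf : f ∈ H) (hg : g ∈ H) (hef : Disjoint e f)
    (hge : g ≠ e) (hgf : g ≠ f) : (covers2 X H).card ≤ 3 := by
  obtain ⟨a, b, hab, rfl⟩ := card_eq_two.1 (h2 e he)
  obtain ⟨c, d, hcd, rfl⟩ := card_eq_two.1 (h2 f hf)
  have hpq : ∃ p ∈ ({a,b} : Finset ℕ), ∃ q ∈ ({c,d} : Finset ℕ), p ∉ g ∧ q ∉ g := by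
    have h1 : ∃ p ∈ ({a,b} : Finset ℕ), p ∉ g := by
      by_contra! h
      exact hge (eq_of_subset_of_card_le h (by rw [h2 _ he, h2 _ hg])).symm
    have h2 : ∃ p ∈ ({c,d} : Finset ℕ), p ∉ g := by
      by_contra! h
      exact hgf (eq_of_subset_of_card_le h (by rw [h2 _ hf, h2 _ hg])).symm
    obtain ⟨p, hp, hp'⟩ := h1
    obtain ⟨q, hq, hq'⟩ := h2
    exact ⟨p, hp, q, hq, hp', hq'⟩
  obtain ⟨p, hp, q, hq, hpg, hqg⟩ := hpq
  have : covers2 X H ⊆ ((({a,b} : Finset ℕ) ×ˢ ({c,d} : Finset ℕ)).erase (p,q)).image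
      (fun z => ({z.1, z.2} : Finset ℕ)) := by
    intro S hS
    simp only [covers2, mem_filter, mem_powersetCard] at hS
    obtain ⟨x, hx⟩ := hS.2 _ he
    obtain ⟨y, hy⟩ := hS.2 _ hf
    obtain ⟨z, hz⟩ := hS.2 _ hg
    rw [mem_inter] at hx hy hz
    have hxy : x ≠ y := by
      rintro rfl
      exact disjoint_left.1 hef hx.2 hy.2
    have hS' : {x, y} = S := eq_of_subset_of_card_le (by simp [insert_subset_iff, hx.1, hy.1])
      (by rw [hS.1.2, card_pair hxy])
    rw [mem_image]
    refine ⟨(x,y), ?_, hS'⟩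
    rw [mem_erase, mem_product]
    refine ⟨?_, hx.2, hy.2⟩
    intro h
    simp only [Prod.mk.injEq] at h
    obtain ⟨rfl, rfl⟩ := h
    rw [← hS'] at hz
    simp only [mem_insert, mem_singleton] at hz
    rcases hz with ⟨rfl | rfl, hz⟩
    · exact hpg hz
    · exact hqg hz
  refine (card_le_card this).trans (card_image_le.trans ?_)
  rw [card_erase_of_mem (mem_product.2 ⟨hp, hq⟩), card_product, card_pair hab, card_pair hcd]

theorem card_edges (X : Finset ℕ) (H : Finset (Finset ℕ)) (hH : H ⊆ powersetCard 2 X)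
    (h : 1 ≤ (covers2 X H).card) : H.card ≤ 2 * X.card := by
  obtain ⟨S, hS⟩ := card_pos.1 h
  simp only [covers2, mem_filter, mem_powersetCard] at hS
  have : H ⊆ (S ×ˢ X).image (fun z => ({z.1, z.2} : Finset ℕ)) := by
    intro e he
    obtain ⟨x, hx⟩ := hS.2 e he
    rw [mem_inter] at hx
    have hee := mem_powersetCard.1 (hH he)
    obtain ⟨p, q, hpq, rfl⟩ := card_eq_two.1 hee.2
    simp only [mem_image, mem_product]
    have hp : p ∈ X := hee.1 (by simp)
    have hq : q ∈ X := hee.1 (by simp)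
    have hx2 := hx.2
    simp only [mem_insert, mem_singleton] at hx2
    rcases hx2 with rfl | rfl
    · exact ⟨(x, q), ⟨hx.1, hq⟩, rfl⟩
    · exact ⟨(x, p), ⟨hx.1, hp⟩, pair_comm _ _⟩
  refine (card_le_card this).trans (card_image_le.trans ?_)
  rw [card_product, hS.1.2]

theorem tri_count (X : Finset ℕ) (k a b c : ℕ) (F : Finset (Finset ℕ)) (hF : F ⊆ powersetCard k X)
    (hab : a ≠ b) (hbc : b ≠ c) (hac : a ≠ c) (ha : a ∈ X) (hb : b ∈ X) (hc : c ∈ X)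
    (h : ∀ A ∈ F, {a,b} ⊆ A ∨ {b,c} ⊆ A ∨ {a,c} ⊆ A) :
    F.card ≤ 3 * (X.card - 3).choose (k-2) + (X.card - 3).choose (k-3) := by
  classical
  have key : ∀ x ∈ X, ∀ y z, y ≠ z →
      ((powersetCard k (X.erase x)).filter (fun A => {y, z} ⊆ A)).card ≤ (X.card - 3).choose (k-2) := by
    intro x hx y z hyz
    have := card_supersets (X.erase x) {y,z} k
    rw [card_pair hyz, card_erase_of_mem hx] at this
    exact this
  have h3 := card_supersets X {a,b,c} k
  rw [card_eq_three.2 ⟨a, b, c, hab, hac, hbc, rfl⟩] at h3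
  have h1 := key c hc a b hab
  have h2 := key a ha b c hbc
  have h4 := key b hb a c hac
  have hsub : F ⊆ ((powersetCard k (X.erase c)).filter (fun A => {a, b} ⊆ A)
      ∪ (powersetCard k (X.erase a)).filter (fun A => {b, c} ⊆ A)) ∪
      ((powersetCard k (X.erase b)).filter (fun A => {a, c} ⊆ A) ∪
        (powersetCard k X).filter (fun A => {a, b, c} ⊆ A)) := by
    intro A hA
    have hA1 := mem_powersetCard.1 (hF hA)
    have hA2 := h A hA
    simp only [mem_union, mem_filter, mem_powersetCard, subset_erase, insert_subset_iff,
      singleton_subset_iff] at hA2 ⊢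
    tauto
  have := card_le_card hsub
  have := card_union_le ((powersetCard k (X.erase c)).filter (fun A => {a, b} ⊆ A)
      ∪ (powersetCard k (X.erase a)).filter (fun A => {b, c} ⊆ A)) 
      ((powersetCard k (X.erase b)).filter (fun A => {a, c} ⊆ A) ∪
        (powersetCard k X).filter (fun A => {a, b, c} ⊆ A))
  have := card_union_le ((powersetCard k (X.erase c)).filter (fun A => {a, b} ⊆ A))
      ((powersetCard k (X.erase a)).filter (fun A => {b, c} ⊆ A))
  have := card_union_le
      ((powersetCard k (X.erase b)).filter (fun A => {a, c} ⊆ A))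
        ((powersetCard k X).filter (fun A => {a, b, c} ⊆ A))
  omega

theorem Jcard (n k : ℕ) (hk : 5 ≤ k) (hn : k + 3 ≤ n) :
    (Jfam n k 3).card + 2 * (n-k-1).choose (k-1)
      = 2 + (n-1).choose (k-1) + (n-k-3).choose (k-1) := by
  have hne : Iset k 1 ≠ Iset k 3 := by
    intro h
    have : 2 ∈ Iset k 1 := by simp [Iset]; omega
    rw [h] at this
    simp [Iset] at this
  have hd : Disjoint ({Iset k 1, Iset k 3} : Finset (Finset ℕ))
    ((Finset.powersetCard k (Finset.Icc 1 n)).filter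
      (fun A => 1 ∈ A ∧ (A ∩ Iset k 1).Nonempty ∧ (A ∩ Iset k 3).Nonempty)) := by
    rw [disjoint_left]
    intro A hA hA'
    have h1 := (mem_filter.1 hA').2.1
    simp only [mem_insert, mem_singleton] at hA
    rcases hA with rfl | rfl <;> simp [Iset] at h1
  have hU : Iset k 1 ⊆ (Icc 1 n).erase 1 := by
    intro x hx; simp [Iset] at hx ⊢; omega
  have hV : Iset k 3 ⊆ (Icc 1 n).erase 1 := by
    intro x hx; simp [Iset] at hx ⊢; omega
  have h := card_hit2 (Icc 1 n) (Iset k 1) (Iset k 3) 1 k (by omega) (by simp; omega) hU hV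
  have hUV : Iset k 1 ∪ Iset k 3 = Icc 2 (k+3) := by
    ext x; simp [Iset]; omega
  rw [hUV] at h
  simp only [Iset, Nat.card_Icc] at h
  rw [Jfam, card_union_of_disjoint hd, card_pair hne]
  simp only [Iset]
  have e1 : n + 1 - 1 - 1 - (k + 1 + 1 - (1 + 1)) = n-k-1 := by omega
  have e2 : n + 1 - 1 - 1 - (k + 3 + 1 - (3 + 1)) = n-k-1 := by omega
  have e3 : n + 1 - 1 - 1 - (k + 3 + 1 - 2) = n-k-3 := by omega
  have e4 : n + 1 - 1 - 1 = n-1 := by omega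
  rw [e1, e2, e3, e4] at h
  omega

set_option maxHeartbeats 4000000 in
theorem main_max (k : ℕ) (hk : 5 ≤ k) (X : Finset ℕ) (hX : 1000 * k^4 + k + 3 ≤ X.card)
    (F : Finset (Finset ℕ)) (hF : F ⊆ powersetCard k X)
    (hi : ∀ A ∈ F, ∀ B ∈ F, (A ∩ B).Nonempty)
    (hm : ∀ A ∈ powersetCard k X, (∀ B ∈ F, (A ∩ B).Nonempty) → A ∈ F)
    (J : ℕ) (hJ : J + 2 * (X.card-k-1).choose (k-1)
      = 2 + (X.card-1).choose (k-1) + (X.card-k-3).choose (k-1)) (hcard : J < F.card) :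
    ∃ i ∈ X, ∃ K : Finset ℕ, K ⊆ X.erase i ∧ K.card = k - 1 ∧ ∀ A ∈ F, i ∈ A ∨ K ⊆ A := by
  classical
  by_contra hno
  obtain ⟨j, rfl⟩ : ∃ j, k = j + 5 := ⟨k-5, by omega⟩
  obtain ⟨m, hXm⟩ : ∃ m, X.card = m + j + 8 := ⟨X.card - j - 8, by omega⟩
  have hm1000 : 1000 * (j+5)^4 ≤ m := by omega
  rw [hXm] at hJ
  have e1 : m + j + 8 - (j+5) - 1 = m + 2 := by omega
  have e2 : m + j + 8 - (j+5) - 3 = m := by omega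
  have e3 : m + j + 8 - 1 = m+j+7 := by omega
  have e4 : j + 5 - 1 = j + 4 := by omega
  rw [e1, e2, e3, e4] at hJ
  have hmj : 1000 * (j + 5) ≤ m := by
    have : (j+5)^4 = (j+5) * (j+5)^3 := by ring
    have := pow_pos (show 0 < j+5 by omega) 3
    nlinarith
  have hmem : ∀ A ∈ F, A ⊆ X ∧ A.card = j+5 := fun A hA => mem_powersetCard.1 (hF hA)
  have hx : ∀ x, ∃ A ∈ F, x ∉ A := by
    intro x
    by_contra! h
    obtain ⟨A, hA⟩ := card_pos.1 (show 0 < F.card by omega)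
    have hxX := (hmem A hA).1 (h A hA)
    obtain ⟨K, hK, hKc⟩ := exists_subset_card_eq (s := X.erase x) (n := j+5-1)
      (by rw [card_erase_of_mem hxX]; omega)
    exact hno ⟨x, hxX, K, hK, hKc, fun A hA => Or.inl (h A hA)⟩
  have hb := branch_card X (j+5) (by omega) F F hF (j+5) (fun e he => (hmem e he).2.le) hx hi
  have hPi := covers_inter X (j+5) (by omega) (by omega) F hi hm
  have hPmem : ∀ S ∈ covers2 X F, S ⊆ X ∧ S.card = 2 ∧ ∀ e ∈ F, (S ∩ e).Nonempty := by
    intro S hS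
    simp only [covers2, mem_filter, mem_powersetCard] at hS
    exact ⟨hS.1.1, hS.1.2, hS.2⟩
  have hP : j + 3 ≤ (covers2 X F).card := by
    by_contra hlt
    have h1 := A1 j m J hm1000 hJ
    have h2 : (covers2 X F).card ≤ j + 2 := by omega
    have h3 := Nat.mul_le_mul_right ((m+j+6).choose (j+3)) h2
    rw [hXm] at hb
    have e5 : m + j + 8 - 2 = m + j + 6 := by omega
    have e6 : m + j + 8 - 3 = m + j + 5 := by omega
    have e7 : j + 5 - 2 = j + 3 := by omega
    have e8 : j + 5 - 3 = j + 2 := by omega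
    rw [e5, e6, e7, e8] at hb
    omega
  have hcen : ∃ c, ∀ S ∈ covers2 X F, c ∈ S := by
    by_contra! h
    obtain ⟨a, b, c, hab, hbc, hac, h1, h2, h3⟩ := tri (covers2 X F) (fun e he => (hPmem e he).2.1) hPi h
    have hle : (covers2 X F).card ≤ 3 := by
      refine (card_le_card ?_).trans (covers_tri X (covers2 X F) a b c hab hbc hac h1 h2 h3)
      intro S hS
      rw [covers2, mem_filter, mem_powersetCard]
      exact ⟨⟨(hPmem S hS).1, (hPmem S hS).2.1⟩, fun T hT => hPi S hS T hT⟩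
    have hj : j = 0 := by omega
    subst hj
    have h4 := tri_count X 5 a b c F hF hab hbc hac ((hPmem _ h1).1 (by simp))
      ((hPmem _ h1).1 (by simp)) ((hPmem _ h2).1 (by simp)) (fun A hA => two_of_three A a b c
        (by rw [inter_comm]; exact (hPmem _ h1).2.2 A hA)
        (by rw [inter_comm]; exact (hPmem _ h2).2.2 A hA)
        (by rw [inter_comm]; exact (hPmem _ h3).2.2 A hA))
    have h5 := A4 m J hm1000 hJ
    rw [hXm] at h4
    have e5 : m + 0 + 8 - 3 = m + 5 := by omega
    rw [e5] at h4
    simp only [Nat.reduceSub] at h4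
    omega
  obtain ⟨c, hc⟩ := hcen
  have hcX : c ∈ X := by
    obtain ⟨S, hS⟩ := card_pos.1 (show 0 < (covers2 X F).card by omega)
    exact (hPmem S hS).1 (hc S hS)
  obtain ⟨L, hL⟩ : ∃ L, L = (X.erase c).filter (fun x => {c, x} ∈ covers2 X F) := ⟨_, rfl⟩
  have hLX : L ⊆ X.erase c := by rw [hL]; exact filter_subset _ _
  have hLsub : ∀ A ∈ F, c ∉ A → L ⊆ A := by
    intro A hA hcA x hxL
    rw [hL, mem_filter] at hxL
    obtain ⟨y, hy⟩ := (hPmem _ hxL.2).2.2 A hA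
    simp only [mem_inter, mem_insert, mem_singleton] at hy
    rcases hy with ⟨rfl | rfl, hy⟩
    · exact absurd hy hcA
    · exact hy
  have hLge : j + 3 ≤ L.card := by
    refine hP.trans ((card_le_card ?_).trans (card_image_le (s := L) (f := fun x => ({c, x} : Finset ℕ))))
    intro S hS
    have hcS := hc S hS
    obtain ⟨p, q, hpq, rfl⟩ := card_eq_two.1 (hPmem S hS).2.1
    have hSX := (hPmem _ hS).1
    simp only [mem_insert, mem_singleton] at hcS
    rw [mem_image]
    rcases hcS with rfl | rfl
    · refine ⟨q, ?_, rfl⟩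
      rw [hL, mem_filter]
      exact ⟨mem_erase.2 ⟨hpq.symm, hSX (by simp)⟩, hS⟩
    · refine ⟨p, ?_, pair_comm _ _⟩
      rw [hL, mem_filter]
      exact ⟨mem_erase.2 ⟨hpq, hSX (by simp)⟩, by rwa [pair_comm]⟩
  have hLle : L.card ≤ j + 3 := by
    by_contra hlt
    obtain ⟨K, hK, hKc⟩ := exists_subset_card_eq (s := L) (n := j+5-1) (by omega)
    refine hno ⟨c, hcX, K, hK.trans hLX, hKc, fun A hA => ?_⟩
    by_cases h : c ∈ A
    · exact Or.inl h
    · exact Or.inr (hK.trans (hLsub A hA h))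
  have hLc : L.card = j + 3 := le_antisymm hLle hLge
  have hcL : c ∉ L := fun h => by simpa using hLX h
  obtain ⟨H, hH⟩ : ∃ H, H = (F.filter (fun A => c ∉ A)).image (fun A => A \ L) := ⟨_, rfl⟩
  have hHmem : ∀ e, e ∈ H ↔ ∃ A ∈ F, c ∉ A ∧ A \ L = e := by
    intro e; rw [hH]; simp [and_assoc]
  have hHcard : H.card = (F.filter (fun A => c ∉ A)).card := by
    rw [hH]
    apply card_image_of_injOn
    intro A hA B hB h
    simp only [coe_filter, Set.mem_ofPred_eq] at hA hB h
    rw [← sdiff_union_of_subset (hLsub A hA.1 hA.2), h, sdiff_union_of_subset (hLsub B hB.1 hB.2)]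
  have hH2 : H ⊆ powersetCard 2 (X.erase c) := by
    intro e he
    obtain ⟨A, hA, hcA, rfl⟩ := (hHmem e).1 he
    rw [mem_powersetCard]
    refine ⟨?_, by rw [card_sdiff_of_subset (hLsub A hA hcA), (hmem A hA).2, hLc]; omega⟩
    exact sdiff_subset.trans (subset_erase.2 ⟨(hmem A hA).1, hcA⟩)
  have hHx : ∀ x, ∃ e ∈ H, x ∉ e := by
    intro x
    by_contra! h
    have h' : ∀ A ∈ F, c ∉ A → x ∈ A ∧ x ∉ L := fun A hA hcA =>
      mem_sdiff.1 (h _ ((hHmem _).2 ⟨A, hA, hcA, rfl⟩))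
    obtain ⟨A, hA, hcA⟩ := hx c
    have hxA := h' A hA hcA
    have hxc : x ≠ c := by rintro rfl; exact hcA hxA.1
    have hxX := (hmem A hA).1 hxA.1
    apply hxA.2
    rw [hL, mem_filter]
    refine ⟨mem_erase.2 ⟨hxc, hxX⟩, ?_⟩
    rw [covers2, mem_filter, mem_powersetCard]
    refine ⟨⟨by simp [insert_subset_iff, hxX, hcX], card_pair hxc.symm⟩, ?_⟩
    intro B hB
    by_cases hcB : c ∈ B
    · exact ⟨c, by simp [hcB]⟩
    · exact ⟨x, by simp [(h' B hB hcB).1]⟩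
  have hsplit : F.card = (F.filter (fun A => c ∈ A ∧ (A ∩ L).Nonempty ∧ (A ∩ L).Nonempty)).card +
      (F.filter (fun A => c ∈ A ∧ ¬ (A ∩ L).Nonempty)).card + H.card := by
    rw [hHcard, card_eq_sum_ones]
    simp only [card_filter, ← sum_add_distrib]
    apply sum_congr rfl
    intro A _
    by_cases c ∈ A <;> by_cases (A ∩ L).Nonempty <;> simp_all
  have hF1 : (F.filter (fun A => c ∈ A ∧ (A ∩ L).Nonempty ∧ (A ∩ L).Nonempty)).card
      + (m+4).choose (j+4) ≤ (m+j+7).choose (j+4) := by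
    have h1 := card_hit2 X L L c (j+5) (by omega) hcX hLX hLX
    have h2 := card_le_card (filter_subset_filter (fun A => c ∈ A ∧ (A ∩ L).Nonempty ∧ (A ∩ L).Nonempty) hF)
    rw [union_self, hLc, hXm, e3, e4, show m + j + 7 - (j+3) = m + 4 by omega] at h1
    omega
  have hF2 : (F.filter (fun A => c ∈ A ∧ ¬ (A ∩ L).Nonempty)).card ≤
      (covers2 (X.erase c) H).card * (m+j+5).choose (j+2) + 8 * (m+j+4).choose (j+1) := by
    have h1 := branch_card (X.erase c) (j+4) (by omega)
      ((F.filter (fun A => c ∈ A ∧ ¬ (A ∩ L).Nonempty)).image (fun A => A.erase c)) H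
      (by
        intro B hB
        obtain ⟨A, hA, rfl⟩ := mem_image.1 hB
        rw [mem_filter] at hA
        rw [mem_powersetCard, card_erase_of_mem hA.2.1, (hmem A hA.1).2]
        exact ⟨erase_subset_erase _ (hmem A hA.1).1, rfl⟩) 2
      (fun e he => (mem_powersetCard.1 (hH2 he)).2.le) hHx
      (by
        intro B hB e he
        obtain ⟨A, hA, rfl⟩ := mem_image.1 hB
        rw [mem_filter, not_nonempty_iff_eq_empty, ← disjoint_iff_inter_eq_empty] at hA
        obtain ⟨D, hD, hcD, rfl⟩ := (hHmem e).1 he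
        obtain ⟨x, hx⟩ := hi A hA.1 D hD
        rw [mem_inter] at hx
        refine ⟨x, ?_⟩
        rw [mem_inter, mem_erase, mem_sdiff]
        refine ⟨⟨?_, hx.1⟩, hx.2, disjoint_left.1 hA.2.2 hx.1⟩
        rintro rfl
        exact hcD hx.2)
    rw [card_image_of_injOn, card_erase_of_mem hcX, hXm] at h1
    · exact h1
    · intro A hA B hB h
      simp only [coe_filter, Set.mem_ofPred_eq] at hA hB h
      rw [← insert_erase hA.2.1, h, insert_erase hB.2.1]
  by_cases hp : (covers2 (X.erase c) H).card ≤ 3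
  · have hXe : (X.erase c).card = m + j + 7 := by rw [card_erase_of_mem hcX, hXm]; omega
    have h1 := A23 j m J hm1000 hJ (covers2 (X.erase c) H).card H.card hp
      (by
        have h2 := card_le_card hH2
        rw [card_powersetCard, hXe] at h2
        exact h2.trans (Nat.choose_le_choose _ (by omega)))
      (by
        intro h
        have h2 := card_edges _ H hH2 h
        rw [hXe] at h2
        omega)
    omega
  · have hHc : ∀ e ∈ H, e.card = 2 := fun e he => (mem_powersetCard.1 (hH2 he)).2
    have hdis : ∃ e ∈ H, ∃ f ∈ H, Disjoint e f := by
      by_contra! h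
      obtain ⟨a, b, d, hab, hbd, had, h1, h2, h3⟩ := tri H hHc
        (fun A hA B hB => by
          have := h A hA B hB
          rwa [disjoint_iff_inter_eq_empty, ← ne_eq, ← nonempty_iff_ne_empty] at this) hHx
      exact hp (covers_tri _ H a b d hab hbd had h1 h2 h3)
    obtain ⟨e, he, f, hf, hef⟩ := hdis
    have honly : ∀ g ∈ H, g = e ∨ g = f := by
      intro g hg
      by_contra! h
      exact hp (covers_disj _ H hHc e f g he hf hg hef h.1 h.2)
    obtain ⟨U, hU, hcU, hUe⟩ := (hHmem e).1 he
    obtain ⟨V, hV, hcV, hVf⟩ := (hHmem f).1 hf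
    have hUu := sdiff_union_of_subset (hLsub U hU hcU)
    have hVu := sdiff_union_of_subset (hLsub V hV hcV)
    have hUV : (U ∪ V).card = j + 7 := by
      have h1 : U ∪ V = (e ∪ f) ∪ L := by
        rw [← hUu, ← hVu, hUe, hVf]
        ext x; simp only [mem_union]; tauto
      have h2 : Disjoint (e ∪ f) L := by
        rw [disjoint_union_left, ← hUe, ← hVf]
        exact ⟨sdiff_disjoint, sdiff_disjoint⟩
      rw [h1, card_union_of_disjoint h2, card_union_of_disjoint hef, hHc e he, hHc f hf, hLc]
      omega
    have h1 := card_hit2 X U V c (j+5) (by omega) hcX (subset_erase.2 ⟨(hmem U hU).1, hcU⟩)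
      (subset_erase.2 ⟨(hmem V hV).1, hcV⟩)
    have hsub : F ⊆ {U, V} ∪ (powersetCard (j+5) X).filter
        (fun A => c ∈ A ∧ (A ∩ U).Nonempty ∧ (A ∩ V).Nonempty) := by
      intro A hA
      rw [mem_union, mem_filter]
      by_cases hcA : c ∈ A
      · exact Or.inr ⟨hF hA, hcA, hi A hA U hU, hi A hA V hV⟩
      · left
        have hAu := sdiff_union_of_subset (hLsub A hA hcA)
        rw [mem_insert, mem_singleton]
        rcases honly _ ((hHmem _).2 ⟨A, hA, hcA, rfl⟩) with h | h
        · left; rw [← hAu, h, ← hUe, hUu]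
        · right; rw [← hAu, h, ← hVf, hVu]
    have h2 := (card_le_card hsub).trans (card_union_le _ _)
    have h3 : ({U, V} : Finset (Finset ℕ)).card ≤ 2 := card_le_two
    rw [hUV, (hmem U hU).2, (hmem V hV).2, hXm, e3, e4, show m + j + 7 - (j+5) = m + 2 by omega,
      show m + j + 7 - (j+7) = m by omega] at h1
    omega

theorem stmt3 (k : ℕ) (hk : 5 ≤ k) :
    ∃ n₀ : ℕ, ∀ n : ℕ, n₀ ≤ n →
      ∀ F : Finset (Finset ℕ), F ⊆ Finset.powersetCard k (Finset.Icc 1 n) →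
        Intersecting F → (Jfam n k 3).card < F.card →
          ∃ i ∈ Finset.Icc 1 n, ∃ K : Finset ℕ,
            K ⊆ (Finset.Icc 1 n).erase i ∧ K.card = k - 1 ∧
              ∀ A ∈ F, i ∈ A ∨ K ⊆ A := by
  refine ⟨1000 * k^4 + k + 3, fun n hn F hF hi hcard => ?_⟩
  obtain ⟨G, hFG, hG, hGi, hGm⟩ := exists_maximal_ext (Icc 1 n) k (by omega) F hF hi
  have hc : (Icc 1 n).card = n := by simp
  obtain ⟨i, hiX, K, h1, h2, h3⟩ := main_max k hk (Icc 1 n) (by omega) G hG hGi hGm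
    (Jfam n k 3).card (by rw [hc]; exact Jcard n k hk (by omega))
    (lt_of_lt_of_le hcard (card_le_card hFG))
  exact ⟨i, hiX, K, h1, h2, fun A hA => h3 A (hFG hA)⟩
end

section
/- Assume n > 2k ≥ 8. Let F be an intersecting family of k-element subsets of [n] with γ(F) = |F(1̄)|. Let M ⊆ F(1̄) be a subfamily which is minimal with respect to common intersection and satisfies |∩_{M∈M} M| = t with t ≥ 3. Let F' := M ∪ {A ∈ C([n],k) : 1 ∈ A and A∩M ≠ ∅ for every M ∈ M} (the unique inclusion-maximal intersecting family in C([n],k) with F'(1̄) = M). Then |F| ≤ |F'|. -/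
/-- The diversity `γ(F) = min_{i ∈ [n]} |F(ī)|`. -/
noncomputable def diversity (n : ℕ) (F : Finset (Finset ℕ)) : ℕ :=
  sInf ((fun i => (F.filter (fun A => i ∉ A)).card) '' (Set.Icc 1 n))

/-- The common intersection `∩_{A ∈ M} A` of a family of subsets of `[n]`. -/
def famInter (n : ℕ) (M : Finset (Finset ℕ)) : Finset ℕ :=
  (Finset.Icc 1 n).filter (fun x => ∀ A ∈ M, x ∈ A)

/-- `M` is minimal w.r.t. common intersection: removing any member strictly increases
the common intersection. -/
def MinimalWrtCommonInt (n : ℕ) (M : Finset (Finset ℕ)) : Prop :=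
  ∀ M' ∈ M, (famInter n M).card < (famInter n (M.erase M')).card

/-- The unique inclusion-maximal intersecting family `F'` in `C([n],k)` with `F'(1̄) = M`:
`F' = M ∪ {A ∈ C([n],k) : 1 ∈ A and A ∩ M ≠ ∅ for all M ∈ M}`. -/
def maxExt (n k : ℕ) (M : Finset (Finset ℕ)) : Finset (Finset ℕ) :=
  M ∪ (Finset.powersetCard k (Finset.Icc 1 n)).filter
    (fun A => 1 ∈ A ∧ ∀ B ∈ M, (A ∩ B).Nonempty)


section Part1
open Finset

open Classical in
/-- `b`-subsets of `U` satisfying `Q` and disjoint from some member of `X`. -/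
noncomputable def NQ (U : Finset ℕ) (b : ℕ) (Q : Finset ℕ → Prop) (X : Finset (Finset ℕ)) :
    Finset (Finset ℕ) :=
  (powersetCard b U).filter (fun B => Q B ∧ ∃ A ∈ X, Disjoint A B)

lemma mem_NQ {U : Finset ℕ} {b : ℕ} {Q : Finset ℕ → Prop} {X : Finset (Finset ℕ)} {B : Finset ℕ} :
    B ∈ NQ U b Q X ↔ (B ⊆ U ∧ B.card = b) ∧ Q B ∧ ∃ A ∈ X, Disjoint A B := by
  simp [NQ, mem_powersetCard]

lemma hall_deg (U : Finset ℕ) (a b : ℕ) (Q : Finset ℕ → Prop) (X : Finset (Finset ℕ))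
    (hX : X ⊆ powersetCard a U) (hab : a + b ≤ U.card)
    (hR : ∀ A ∈ X, ∃ R, R ⊆ U \ A ∧ R.card + a ≤ b ∧
      ∀ B, B ⊆ U → R ⊆ B → Disjoint A B → Q B) :
    X.card ≤ (NQ U b Q X).card := by
  classical
  have key : X.card * (U.card - b).choose a ≤ (NQ U b Q X).card * (U.card - b).choose a := by
    apply card_mul_le_card_mul (fun A B => Disjoint A B)
    · intro A hA
      obtain ⟨R, hRU, hRc, hQ⟩ := hR A hA
      have hA' := mem_powersetCard.1 (hX hA)
      have hsub : ((powersetCard (b - R.card) ((U \ A) \ R)).image (fun C => R ∪ C)) ⊆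
          (NQ U b Q X).bipartiteAbove (fun A B => Disjoint A B) A := by
        intro B hB
        obtain ⟨C, hC, rfl⟩ := mem_image.1 hB
        obtain ⟨hC1, hC2⟩ := mem_powersetCard.1 hC
        have hd : Disjoint A (R ∪ C) := by
          rw [disjoint_left]; intro x hx hx2
          rcases mem_union.1 hx2 with h | h
          · exact (mem_sdiff.1 (hRU h)).2 hx
          · exact (mem_sdiff.1 (mem_sdiff.1 (hC1 h)).1).2 hx
        have hs : R ∪ C ⊆ U := by
          apply union_subset
          · exact hRU.trans sdiff_subset
          · exact hC1.trans (sdiff_subset.trans sdiff_subset)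
        rw [mem_bipartiteAbove, mem_NQ]
        refine ⟨⟨⟨hs, ?_⟩, hQ _ hs subset_union_left hd, A, hA, hd⟩, hd⟩
        rw [card_union_of_disjoint, hC2]
        · omega
        · rw [disjoint_left]; intro x hx hx2
          exact (mem_sdiff.1 (hC1 hx2)).2 hx
      refine le_trans ?_ (card_le_card hsub)
      rw [card_image_of_injOn, card_powersetCard, card_sdiff_of_subset hRU,
        card_sdiff_of_subset hA'.1, hA'.2]
      · have h1 : (U.card - b).choose a = (U.card - b).choose (U.card - b - a) :=
          (Nat.choose_symm (by omega)).symm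
        have h2 : (U.card - a - R.card).choose (b - R.card)
            = (U.card - a - R.card).choose (U.card - b - a) := by
          rw [← Nat.choose_symm (by omega)]
          congr 1; omega
        rw [h1, h2]
        exact Nat.choose_le_choose _ (by omega)
      · intro C hC D hD h
        rw [mem_coe, mem_powersetCard] at hC hD
        have e : ∀ C : Finset ℕ, C ⊆ (U \ A) \ R → (R ∪ C) \ R = C := by
          intro C hC
          rw [union_sdiff_left]
          apply sdiff_eq_self_of_disjoint
          rw [disjoint_left]; intro x hx hx2
          exact (mem_sdiff.1 (hC hx)).2 hx2
        have h' : R ∪ C = R ∪ D := h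
        rw [← e C hC.1, ← e D hD.1, h']
    · intro B hB
      have hB' := (mem_NQ.1 hB).1
      have : X.bipartiteBelow (fun A B => Disjoint A B) B ⊆ powersetCard a (U \ B) := by
        intro A hA
        rw [mem_bipartiteBelow] at hA
        have hA' := mem_powersetCard.1 (hX hA.1)
        rw [mem_powersetCard]
        exact ⟨subset_sdiff.2 ⟨hA'.1, hA.2⟩, hA'.2⟩
      refine (card_le_card this).trans ?_
      rw [card_powersetCard, card_sdiff_of_subset hB'.1, hB'.2]
  exact Nat.le_of_mul_le_mul_right key (Nat.choose_pos (by omega))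

/-- the link at `x`. -/
def lk (x : ℕ) (X : Finset (Finset ℕ)) : Finset (Finset ℕ) :=
  (X.filter (fun A => x ∈ A)).image (fun A => A.erase x)

lemma mem_lk {x : ℕ} {X : Finset (Finset ℕ)} {A : Finset ℕ} :
    A ∈ lk x X ↔ x ∉ A ∧ insert x A ∈ X := by
  unfold lk
  rw [mem_image]
  constructor
  · rintro ⟨B, hB, rfl⟩
    rw [mem_filter] at hB
    exact ⟨by simp, by rw [insert_erase hB.2]; exact hB.1⟩
  · rintro ⟨h1, h2⟩
    exact ⟨insert x A, by simp [h2], by rw [erase_insert h1]⟩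

lemma card_lk (x : ℕ) (X : Finset (Finset ℕ)) :
    (lk x X).card = (X.filter (fun A => x ∈ A)).card := by
  unfold lk
  apply card_image_of_injOn
  intro A hA B hB h
  rw [mem_coe, mem_filter] at hA hB
  have h' : A.erase x = B.erase x := h
  rw [← insert_erase hA.2, ← insert_erase hB.2, h']

lemma card_lk_add (x : ℕ) (X : Finset (Finset ℕ)) :
    X.card = (X.filter (fun A => x ∉ A)).card + (lk x X).card := by
  rw [card_lk, add_comm]
  exact (card_filter_add_card_filter_not _).symm

lemma lk_subset {x : ℕ} {X : Finset (Finset ℕ)} {U : Finset ℕ} {a : ℕ}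
    (hX : X ⊆ powersetCard a U) : lk x X ⊆ powersetCard (a - 1) (U.erase x) := by
  intro A hA
  rw [mem_lk] at hA
  have := mem_powersetCard.1 (hX hA.2)
  rw [card_insert_of_notMem hA.1] at this
  rw [mem_powersetCard]
  exact ⟨subset_erase.2 ⟨(subset_insert _ _).trans this.1, hA.1⟩, by omega⟩

lemma del_subset {x : ℕ} {X : Finset (Finset ℕ)} {U : Finset ℕ} {a : ℕ}
    (hX : X ⊆ powersetCard a U) :
    X.filter (fun A => x ∉ A) ⊆ powersetCard a (U.erase x) := by
  intro A hA
  rw [mem_filter] at hA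
  have := mem_powersetCard.1 (hX hA.1)
  rw [mem_powersetCard]
  exact ⟨subset_erase.2 ⟨this.1, hA.2⟩, this.2⟩

lemma hall_split (U : Finset ℕ) (b x : ℕ) (hx : x ∈ U) (Q : Finset ℕ → Prop)
    (X : Finset (Finset ℕ))
    (h1 : (X.filter (fun A => x ∉ A)).card ≤
      (NQ (U.erase x) b (fun B => Q (insert x B)) (X.filter (fun A => x ∉ A))).card)
    (h2 : (lk x X).card ≤ (NQ (U.erase x) (b + 1) Q (lk x X)).card) :
    X.card ≤ (NQ U (b + 1) Q X).card := by
  rw [card_lk_add x X, card_lk_add x (NQ U (b + 1) Q X), add_comm]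
  apply add_le_add
  · refine h2.trans (card_le_card ?_)
    intro B hB
    rw [mem_NQ] at hB
    obtain ⟨⟨hB1, hB2⟩, hB3, A, hA, hAB⟩ := hB
    rw [subset_erase] at hB1
    rw [mem_filter, mem_NQ]
    rw [mem_lk] at hA
    exact ⟨⟨⟨hB1.1, hB2⟩, hB3, _, hA.2, by rw [disjoint_insert_left]; exact ⟨hB1.2, hAB⟩⟩, hB1.2⟩
  · refine h1.trans (card_le_card ?_)
    intro B hB
    rw [mem_NQ] at hB
    obtain ⟨⟨hB1, hB2⟩, hB3, A, hA, hAB⟩ := hB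
    rw [subset_erase] at hB1
    rw [mem_filter] at hA
    rw [mem_lk, mem_NQ]
    refine ⟨hB1.2, ⟨insert_subset hx hB1.1, ?_⟩, hB3, A, hA.1, ?_⟩
    · rw [card_insert_of_notMem hB1.2, hB2]
    · rw [disjoint_insert_right]; exact ⟨hA.2, hAB⟩

lemma hall_witness (P : Finset ℕ) : ∀ (U : Finset ℕ) (a b : ℕ) (Q : Finset ℕ → Prop)
    (X : Finset (Finset ℕ)) (_ : X ⊆ powersetCard a U) (_ : a + b ≤ U.card) (_ : a < b) (_ : P ⊆ U)
    (_ : ∀ A ∈ X, ∀ x ∈ P, x ∉ A → ∃ R, R ⊆ U \ A ∧ x ∈ R ∧ R.card + a ≤ b ∧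
      ∀ B, B ⊆ U → R ⊆ B → Disjoint A B → Q B)
    (_ : ∀ A ∈ X, P ⊆ A → ∃ R, R ⊆ U \ A ∧ R.card + a ≤ b + P.card ∧
      ∀ B, B ⊆ U → R ⊆ B → Disjoint A B → Q B),
    X.card ≤ (NQ U b Q X).card := by
  induction P using Finset.induction_on with
  | empty =>
    intro U a b Q X hX hab _ _ _ h
    apply hall_deg U a b Q X hX hab
    intro A hA
    obtain ⟨R, h1, h2, h3⟩ := h A hA (empty_subset _)
    exact ⟨R, h1, by simpa using h2, h3⟩
  | insert x P hxP ih =>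
    intro U a b Q X hX hab hlt hPU h1 h2
    have hxU : x ∈ U := hPU (mem_insert_self _ _)
    have hUc : (U.erase x).card + 1 = U.card := card_erase_add_one hxU
    rcases b with _ | b
    · omega
    · apply hall_split U b x hxU
      · apply hall_deg _ a b _ _ (del_subset hX) (by omega)
        intro A hA
        rw [mem_filter] at hA
        obtain ⟨R, hR1, hxR, hR2, hR3⟩ := h1 A hA.1 x (mem_insert_self _ _) hA.2
        refine ⟨R.erase x, ?_, ?_, ?_⟩
        · intro y hy
          rw [mem_erase] at hy
          have := hR1 hy.2
          rw [mem_sdiff] at this ⊢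
          exact ⟨mem_erase.2 ⟨hy.1, this.1⟩, this.2⟩
        · have := card_erase_add_one hxR
          omega
        · intro B hB hRB hd
          apply hR3
          · exact insert_subset hxU (hB.trans (erase_subset _ _))
          · rw [← insert_erase hxR]; exact insert_subset_insert _ hRB
          · rw [disjoint_insert_right]; exact ⟨hA.2, hd⟩
      · by_cases ha : a = 0
        · have : lk x X = ∅ := by
            rw [eq_empty_iff_forall_notMem]
            intro A hA
            rw [mem_lk] at hA
            have := (mem_powersetCard.1 (hX hA.2)).2
            rw [ha, card_insert_of_notMem hA.1] at this
            omega
          rw [this]; simp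
        · apply ih _ (a - 1) _ _ _ (lk_subset hX) (by omega) (by omega)
          · exact subset_erase.2 ⟨(subset_insert _ _).trans hPU, hxP⟩
          · intro A hA y hy hyA
            rw [mem_lk] at hA
            have hyx : y ≠ x := by rintro rfl; exact hxP hy
            obtain ⟨R, hR1, hxR, hR2, hR3⟩ := h1 _ hA.2 y (mem_insert_of_mem hy)
              (by simp [hyx, hyA])
            refine ⟨R, ?_, hxR, by omega, ?_⟩
            · intro z hz
              have := hR1 hz
              simp only [mem_sdiff, mem_insert, not_or, mem_erase] at this ⊢
              tauto
            · intro B hB hRB hd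
              rw [subset_erase] at hB
              exact hR3 B hB.1 hRB (by rw [disjoint_insert_left]; exact ⟨hB.2, hd⟩)
          · intro A hA hPA
            rw [mem_lk] at hA
            obtain ⟨R, hR1, hR2, hR3⟩ := h2 _ hA.2 (insert_subset_insert _ hPA)
            rw [card_insert_of_notMem hxP] at hR2
            refine ⟨R, ?_, by omega, ?_⟩
            · intro z hz
              have := hR1 hz
              simp only [mem_sdiff, mem_insert, not_or, mem_erase] at this ⊢
              tauto
            · intro B hB hRB hd
              rw [subset_erase] at hB
              exact hR3 B hB.1 hRB (by rw [disjoint_insert_left]; exact ⟨hB.2, hd⟩)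

end Part1

section Part2
open Finset
open scoped FinsetFamily

/-- All `q`-subsets of members of `X`. -/
def Sh (q : ℕ) (X : Finset (Finset ℕ)) : Finset (Finset ℕ) := X.biUnion (powersetCard q)

lemma mem_Sh {q : ℕ} {X : Finset (Finset ℕ)} {B : Finset ℕ} :
    B ∈ Sh q X ↔ ∃ C ∈ X, B ⊆ C ∧ B.card = q := by
  simp [Sh, mem_powersetCard]

lemma exists_initSeg_card (N r : ℕ) : ∀ s, s ≤ N.choose r →
    ∃ C : Finset (Finset (Fin N)), C.card = s ∧ Colex.IsInitSeg C r := by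
  intro s
  induction s with
  | zero => intro _; exact ⟨∅, rfl, Colex.isInitSeg_empty⟩
  | succ s ih =>
    intro hs
    obtain ⟨C, hC, hI⟩ := ih (by omega)
    have hne : ((powersetCard r (univ : Finset (Fin N))) \ C).Nonempty := by
      rw [← card_pos]
      have := le_card_sdiff C (powersetCard r (univ : Finset (Fin N)))
      rw [card_powersetCard, card_univ, Fintype.card_fin] at this
      omega
    obtain ⟨m, hm, hmin⟩ := exists_min_image _ (fun s => toColex s) hne
    rw [mem_sdiff, mem_powersetCard] at hm
    refine ⟨insert m C, by rw [card_insert_of_notMem hm.2, hC], ?_, ?_⟩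
    · intro t ht
      rw [mem_coe, mem_insert] at ht
      rcases ht with rfl | ht
      · exact hm.1.2
      · exact hI.1 ht
    · intro s t hs ⟨hlt, ht⟩
      rw [mem_insert] at hs ⊢
      by_cases htC : t ∈ C
      · exact Or.inr htC
      · exfalso
        have h1 := hmin t (by rw [mem_sdiff, mem_powersetCard]; exact ⟨⟨subset_univ _, ht⟩, htC⟩)
        rcases hs with rfl | hs
        · exact absurd hlt (not_lt.2 h1)
        · exact htC (hI.2 hs ⟨hlt, ht⟩)

/-- embed finsets of `Fin N` in finsets of naturals -/
def eF (N : ℕ) (D : Finset (Fin N)) : Finset ℕ := D.map Fin.valEmbedding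

lemma eF_inj (N : ℕ) : Function.Injective (eF N) := Finset.map_injective _

lemma eF_surj (N : ℕ) (C : Finset ℕ) (hC : C ⊆ range N) : ∃ D, eF N D = C := by
  refine ⟨univ.filter (fun i : Fin N => (i : ℕ) ∈ C), ?_⟩
  ext x
  simp only [eF, mem_map, mem_filter, mem_univ, true_and, Fin.valEmbedding_apply]
  constructor
  · rintro ⟨a, ha, rfl⟩; exact ha
  · intro hx
    exact ⟨⟨x, mem_range.1 (hC hx)⟩, hx, rfl⟩

lemma eF_subset (N : ℕ) (D : Finset (Fin N)) : eF N D ⊆ range N := by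
  intro x hx
  simp only [eF, mem_map, Fin.valEmbedding_apply] at hx
  obtain ⟨a, _, rfl⟩ := hx
  exact mem_range.2 a.2

lemma Sh_eF (N r q : ℕ) (hqr : q ≤ r) (D : Finset (Finset (Fin N)))
    (hD : (D : Set (Finset (Fin N))).Sized r) :
    (Sh q (D.image (eF N))).card = (∂^[r - q] D).card := by
  rw [← card_image_of_injective _ (eF_inj N)]
  congr 1
  ext B
  rw [mem_Sh, mem_image]
  constructor
  · rintro ⟨C, hC, hBC, hB⟩
    obtain ⟨C', hC', rfl⟩ := mem_image.1 hC
    obtain ⟨B', rfl⟩ := eF_surj N B (hBC.trans (eF_subset _ _))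
    refine ⟨B', ?_, rfl⟩
    rw [mem_shadow_iterate_iff_exists_mem_card_add]
    refine ⟨C', hC', by simpa [eF] using hBC, ?_⟩
    rw [eF, card_map] at hB
    rw [hD hC', hB]; omega
  · rintro ⟨B', hB', rfl⟩
    rw [mem_shadow_iterate_iff_exists_mem_card_add] at hB'
    obtain ⟨C', hC', hs, hc⟩ := hB'
    refine ⟨eF N C', mem_image_of_mem _ hC', by simpa [eF] using hs, ?_⟩
    rw [hD hC'] at hc
    rw [eF, card_map]; omega

lemma range_initSeg (N r m : ℕ) (hm : m ≤ N) :
    ∃ R : Finset (Finset (Fin N)), Colex.IsInitSeg R r ∧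
      R.image (eF N) = powersetCard r (range m) := by
  obtain ⟨K, hK⟩ := eF_surj N (range m) (range_subset_range.2 hm)
  refine ⟨powersetCard r K, ⟨Set.sized_powersetCard _ _, ?_⟩, ?_⟩
  · simp_rw [mem_powersetCard]
    rintro A B hA ⟨HB₁, HB₂⟩
    refine ⟨fun t ht ↦ ?_, ‹_›⟩
    have : toColex (image Fin.val B) < toColex (image Fin.val A) := by
      rwa [Colex.toColex_image_lt_toColex_image Fin.val_strictMono]
    have h2 : (t : ℕ) < m := by
      apply Colex.forall_lt_mono this.le _ t (mem_image.2 ⟨t, ht, rfl⟩)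
      simp_rw [mem_image]
      rintro _ ⟨a, ha, rfl⟩
      have : (a : ℕ) ∈ eF N K := by simp only [eF, mem_map]; exact ⟨a, hA.1 ha, rfl⟩
      rw [hK] at this
      exact mem_range.1 this
    rw [← mem_range, ← hK] at h2
    simpa [eF, Fin.val_inj] using h2
  · ext C
    rw [mem_image, mem_powersetCard, ← hK]
    constructor
    · rintro ⟨D, hD, rfl⟩
      rw [mem_powersetCard] at hD
      exact ⟨by simpa [eF] using hD.1, by rw [eF, card_map]; exact hD.2⟩
    · rintro ⟨h1, h2⟩
      obtain ⟨D, rfl⟩ := eF_surj N C (h1.trans (eF_subset _ _))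
      refine ⟨D, mem_powersetCard.2 ⟨by simpa [eF] using h1, ?_⟩, rfl⟩
      rwa [eF, card_map] at h2

lemma kk_red (N r q : ℕ) (hqr : q ≤ r) (X : Finset (Finset ℕ))
    (hX : X ⊆ powersetCard r (range N)) :
    ∃ C : Finset (Finset ℕ), C.card = X.card ∧ (Sh q C).card ≤ (Sh q X).card ∧
      ∀ m ≤ N, (X.card ≤ m.choose r → C ⊆ powersetCard r (range m)) ∧
        (m.choose r ≤ X.card → powersetCard r (range m) ⊆ C) := by
  obtain ⟨D, hDX⟩ : ∃ D : Finset (Finset (Fin N)), D.image (eF N) = X := by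
    refine ⟨univ.filter (fun D => eF N D ∈ X), ?_⟩
    ext C
    simp only [mem_image, mem_filter, mem_univ, true_and]
    constructor
    · rintro ⟨a, ha, rfl⟩; exact ha
    · intro hC
      obtain ⟨D, rfl⟩ := eF_surj N C (mem_powersetCard.1 (hX hC)).1
      exact ⟨D, hC, rfl⟩
  have hDr : (D : Set (Finset (Fin N))).Sized r := by
    intro A hA
    have : eF N A ∈ X := by rw [← hDX]; exact mem_image_of_mem _ hA
    have := (mem_powersetCard.1 (hX this)).2
    rwa [eF, card_map] at this
  have hDc : D.card = X.card := by rw [← hDX, card_image_of_injective _ (eF_inj N)]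
  have hXc : X.card ≤ N.choose r := by
    have := card_le_card hX
    rwa [card_powersetCard, card_range] at this
  obtain ⟨C, hC, hI⟩ := exists_initSeg_card N r X.card hXc
  refine ⟨C.image (eF N), ?_, ?_, ?_⟩
  · rw [card_image_of_injective _ (eF_inj N), hC]
  · rw [Sh_eF N r q hqr C hI.1, ← hDX, Sh_eF N r q hqr D hDr]
    exact iterated_kk hDr (by omega) hI
  · intro m hm
    obtain ⟨R, hR, hRe⟩ := range_initSeg N r m hm
    have hRc : R.card = m.choose r := by
      rw [← card_image_of_injective _ (eF_inj N), hRe, card_powersetCard, card_range]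
    rw [← hRe]
    constructor
    · intro h
      apply image_subset_image
      rcases hI.total hR with h' | h'
      · exact h'
      · rw [eq_of_subset_of_card_le h' (by omega)]
    · intro h
      apply image_subset_image
      rcases hI.total hR with h' | h'
      · rw [eq_of_subset_of_card_le h' (by omega)]
      · exact h'

/-- complement family -/
def cpl (U : Finset ℕ) (X : Finset (Finset ℕ)) : Finset (Finset ℕ) := X.image (fun A => U \ A)

lemma cpl_subset {U : Finset ℕ} {X : Finset (Finset ℕ)} {a : ℕ} (hX : X ⊆ powersetCard a U) :
    cpl U X ⊆ powersetCard (U.card - a) U := by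
  intro B hB
  obtain ⟨A, hA, rfl⟩ := mem_image.1 hB
  have := mem_powersetCard.1 (hX hA)
  rw [mem_powersetCard]
  exact ⟨sdiff_subset, by rw [card_sdiff_of_subset this.1, this.2]⟩

lemma card_cpl {U : Finset ℕ} {X : Finset (Finset ℕ)} {a : ℕ} (hX : X ⊆ powersetCard a U) :
    (cpl U X).card = X.card := by
  apply card_image_of_injOn
  intro A hA B hB h
  have hA' := (mem_powersetCard.1 (hX (mem_coe.1 hA))).1
  have hB' := (mem_powersetCard.1 (hX (mem_coe.1 hB))).1
  have h' : U \ A = U \ B := h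
  rw [← Finset.sdiff_sdiff_eq_self hA', ← Finset.sdiff_sdiff_eq_self hB', h']

lemma NQ_eq_Sh_cpl {U : Finset ℕ} {X : Finset (Finset ℕ)} (b : ℕ) :
    NQ U b (fun _ => True) X = Sh b (cpl U X) := by
  ext B
  rw [mem_NQ, mem_Sh]
  constructor
  · rintro ⟨⟨h1, h2⟩, _, A, hA, hAB⟩
    exact ⟨U \ A, mem_image_of_mem _ hA, subset_sdiff.2 ⟨h1, hAB.symm⟩, h2⟩
  · rintro ⟨C, hC, hBC, hB⟩
    obtain ⟨A, hA, rfl⟩ := mem_image.1 hC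
    rw [subset_sdiff] at hBC
    exact ⟨⟨hBC.1, hB⟩, trivial, A, hA, hBC.2.symm⟩

lemma Sh_le_of_subset (U : Finset ℕ) (r q : ℕ) (X : Finset (Finset ℕ))
    (hX : X ⊆ powersetCard r U) (hqr : q ≤ r) (hU : U.card ≤ q + r) :
    X.card ≤ (Sh q X).card := by
  by_cases hr : r ≤ U.card
  · have h1 := cpl_subset hX
    have h2 : cpl U (cpl U X) = X := by
      unfold cpl
      rw [image_image]
      conv_rhs => rw [← image_id (s := X)]
      apply image_congr
      intro A hA
      have hA' := (mem_powersetCard.1 (hX (mem_coe.1 hA))).1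
      simp [hA']
    rw [← card_cpl hX]
    conv_rhs => rw [← h2]
    rw [← NQ_eq_Sh_cpl q]
    apply hall_deg U (U.card - r) q _ _ h1 (by omega)
    intro A _
    exact ⟨∅, empty_subset _, by simp; omega, fun _ _ _ _ => trivial⟩
  · rw [powersetCard_eq_empty.2 (by omega), subset_empty] at hX
    simp [hX]

lemma kk_small (U : Finset ℕ) (r q m : ℕ) (X : Finset (Finset ℕ))
    (hX : X ⊆ powersetCard r U) (hqr : q ≤ r) (hm : m ≤ q + r) (hc : X.card ≤ m.choose r) :
    X.card ≤ (Sh q X).card := by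
  obtain ⟨N0, hN0⟩ := U.exists_nat_subset_range
  obtain ⟨C, hC, hS, h⟩ := kk_red (max N0 m) r q hqr X
    (hX.trans (powersetCard_mono (hN0.trans (range_subset_range.2 (le_max_left _ _)))))
  rw [← hC]
  refine le_trans ?_ hS
  exact Sh_le_of_subset (range m) r q C ((h m (le_max_right _ _)).1 hc) hqr (by simpa using hm)

lemma kk_gen (U : Finset ℕ) (r q m : ℕ) (X : Finset (Finset ℕ))
    (hX : X ⊆ powersetCard r U) (hqr : q ≤ r) (hq : 1 ≤ q) (hrm : r ≤ m) (hm : m + 2 ≤ q + r)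
    (hc1 : m.choose r ≤ X.card) (hc2 : X.card ≤ (m + 1).choose r) :
    X.card + m.choose q ≤ (Sh q X).card + m.choose r := by
  obtain ⟨N0, hN0⟩ := U.exists_nat_subset_range
  obtain ⟨C, hC, hS, h⟩ := kk_red (max N0 (m + 1)) r q hqr X
    (hX.trans (powersetCard_mono (hN0.trans (range_subset_range.2 (le_max_left _ _)))))
  have hC1 := (h (m + 1) (le_max_right _ _)).1 hc2
  have hC2 := (h m ((Nat.le_succ m).trans (le_max_right _ _))).2 hc1
  have hre : (range (m + 1)).erase m = range m := by
    ext x; simp; omega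
  have e1 : (C.filter (fun A => m ∉ A)).card ≤ m.choose r := by
    have := card_le_card (del_subset (x := m) hC1)
    rwa [hre, card_powersetCard, card_range] at this
  have e2 : m.choose q ≤ ((Sh q C).filter (fun A => m ∉ A)).card := by
    have hs : powersetCard q (range m) ⊆ (Sh q C).filter (fun A => m ∉ A) := by
      intro B hB
      rw [mem_powersetCard] at hB
      rw [mem_filter, mem_Sh]
      refine ⟨?_, fun hmB => by simpa using hB.1 hmB⟩
      obtain ⟨D, hD1, hD2, hD3⟩ := exists_subsuperset_card_eq hB.1 (n := r) (by omega)
        (by simpa using hrm)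
      exact ⟨D, hC2 (mem_powersetCard.2 ⟨hD2, hD3⟩), hD1, hB.2⟩
    have := card_le_card hs
    rwa [card_powersetCard, card_range] at this
  have e3 : (lk m C).card ≤ (lk m (Sh q C)).card := by
    have hl := lk_subset (x := m) hC1
    rw [hre] at hl
    refine (Sh_le_of_subset (range m) (r - 1) (q - 1) _ hl (by omega)
      (by rw [card_range]; omega)).trans (card_le_card ?_)
    intro B hB
    rw [mem_Sh] at hB
    obtain ⟨D, hD, hBD, hBc⟩ := hB
    rw [mem_lk] at hD
    rw [mem_lk, mem_Sh]
    have hmB : m ∉ B := fun h => hD.1 (hBD h)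
    exact ⟨hmB, _, hD.2, insert_subset_insert _ hBD, by rw [card_insert_of_notMem hmB]; omega⟩
  have f1 := card_lk_add m C
  have f2 := card_lk_add m (Sh q C)
  omega

/-- Hall-type form of `kk_small`. -/
lemma hall_kk (U : Finset ℕ) (a b m : ℕ) (X : Finset (Finset ℕ)) (hX : X ⊆ powersetCard a U)
    (Q : Finset ℕ → Prop) (hQ : ∀ B, Q B)
    (hab : a + b ≤ U.card) (hm : m + a ≤ b + U.card) (hc : X.card ≤ m.choose (U.card - a)) :
    X.card ≤ (NQ U b Q X).card := by
  have : Q = fun _ => True := by funext B; simp [hQ B]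
  rw [this, NQ_eq_Sh_cpl b]
  have h := kk_small U (U.card - a) b m _ (cpl_subset hX) (by omega) (by omega)
    (by rw [card_cpl hX]; exact hc)
  rwa [card_cpl hX] at h

end Part2

section Part3
open Finset

lemma hall_split_in (U : Finset ℕ) (b x : ℕ) (Q : Finset ℕ → Prop)
    (X : Finset (Finset ℕ)) (hX : ∀ A ∈ X, x ∈ A)
    (h2 : (lk x X).card ≤ (NQ (U.erase x) b Q (lk x X)).card) :
    X.card ≤ (NQ U b Q X).card := by
  have : X.filter (fun A => x ∈ A) = X := filter_true_of_mem hX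
  rw [card_lk, this] at h2
  refine h2.trans (card_le_card ?_)
  intro B hB
  rw [mem_NQ] at hB
  obtain ⟨⟨hB1, hB2⟩, hB3, A, hA, hAB⟩ := hB
  rw [subset_erase] at hB1
  rw [mem_NQ]
  rw [mem_lk] at hA
  exact ⟨⟨hB1.1, hB2⟩, hB3, _, hA.2, by rw [disjoint_insert_left]; exact ⟨hB1.2, hAB⟩⟩

/-- the walk of `A` along `l` reaches height `h` -/
def Reach (l : List ℕ) (h : ℕ) (A : Finset ℕ) : Prop :=
  ∃ l1 l2, l = l1 ++ l2 ∧ l1.length + h ≤ 2 * (l1.filter (fun y => y ∈ A)).length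

lemma reach_cons_notMem {x : ℕ} {l : List ℕ} {h : ℕ} {A : Finset ℕ} (hx : x ∉ A)
    (hr : Reach (x :: l) (h + 1) A) : Reach l (h + 2) A := by
  obtain ⟨l1, l2, h1, h2⟩ := hr
  rcases l1 with _ | ⟨y, l1⟩
  · simp at h2
  · simp only [List.cons_append, List.cons.injEq] at h1
    obtain ⟨rfl, rfl⟩ := h1
    rw [List.filter_cons_of_neg (by simpa using hx)] at h2
    exact ⟨l1, l2, rfl, by simp at h2 ⊢; omega⟩

lemma reach_cons_mem {x : ℕ} {l : List ℕ} {h : ℕ} {A : Finset ℕ} (hl : x ∉ l)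
    (hr : Reach (x :: l) (h + 1) (insert x A)) : Reach l h A := by
  obtain ⟨l1, l2, h1, h2⟩ := hr
  rcases l1 with _ | ⟨y, l1⟩
  · simp at h2
  · simp only [List.cons_append, List.cons.injEq] at h1
    obtain ⟨rfl, rfl⟩ := h1
    rw [List.filter_cons_of_pos (by simp)] at h2
    have : l1.filter (fun y => y ∈ insert x A) = l1.filter (fun y => y ∈ A) := by
      apply List.filter_congr
      intro z hz
      have : z ≠ x := by rintro rfl; exact hl (List.mem_append_left _ hz)
      simp [this]
    rw [this] at h2
    exact ⟨l1, l2, rfl, by simp at h2 ⊢; omega⟩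

lemma reach_le_card {l : List ℕ} {h : ℕ} {A : Finset ℕ} (hl : l.Nodup) (hr : Reach l h A) :
    h ≤ A.card := by
  obtain ⟨l1, l2, rfl, h2⟩ := hr
  have h3 : (l1.filter (fun y => y ∈ A)).length ≤ l1.length := List.length_filter_le _ _
  have h4 : (l1.filter (fun y => y ∈ A)).length ≤ A.card := by
    rw [← List.toFinset_card_of_nodup]
    · apply card_le_card
      intro y hy
      simp at hy
      exact hy.2
    · exact (List.Nodup.of_append_left hl).filter _
  omega

lemma hall_walk (l : List ℕ) : ∀ (_ : l.Nodup) (a b h : ℕ) (X : Finset (Finset ℕ))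
    (_ : X ⊆ powersetCard a l.toFinset) (_ : a + b ≤ l.length) (_ : a ≤ b + h)
    (_ : ∀ A ∈ X, Reach l h A), X.card ≤ (NQ l.toFinset b (fun _ => True) X).card := by
  induction l with
  | nil =>
    intro _ a b h X hX hab _ hr
    apply hall_deg _ a b _ _ hX (by simpa using hab)
    intro A _
    exact ⟨∅, empty_subset _, by simp at hab ⊢; omega, fun _ _ _ _ => trivial⟩
  | cons x l ih =>
    intro hn a b h X hX hab hle hr
    have hc : (x :: l).toFinset.card = l.length + 1 := by
      rw [List.toFinset_card_of_nodup hn]; simp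
    simp only [List.length_cons] at hab
    rcases h with _ | h
    · apply hall_deg _ a b _ _ hX (by omega)
      intro A _
      exact ⟨∅, empty_subset _, by simp; omega, fun _ _ _ _ => trivial⟩
    · have hxl : x ∉ l := (List.nodup_cons.1 hn).1
      have hnl : l.Nodup := (List.nodup_cons.1 hn).2
      have hxU : x ∈ (x :: l).toFinset := by simp
      have hUe : ((x :: l).toFinset).erase x = l.toFinset := by
        rw [List.toFinset_cons, erase_insert (by simpa using hxl)]
      have hlk := lk_subset (x := x) hX
      have hdel := del_subset (x := x) hX
      rw [hUe] at hlk hdel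
      have hlkh : ∀ b', a + b' ≤ l.length + 1 → a ≤ b' + (h + 1) →
          (lk x X).card ≤ (NQ l.toFinset b' (fun _ => True) (lk x X)).card := by
        intro b' h1 h2
        by_cases ha : a = 0
        · have : lk x X = ∅ := by
            rw [eq_empty_iff_forall_notMem]
            intro A hA
            rw [mem_lk] at hA
            have := (mem_powersetCard.1 (hX hA.2)).2
            rw [ha, card_insert_of_notMem hA.1] at this
            omega
          rw [this]; simp
        apply ih hnl (a - 1) b' h _ hlk (by omega) (by omega)
        intro A hA
        rw [mem_lk] at hA
        exact reach_cons_mem hxl (hr _ hA.2)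
      rcases b with _ | b
      · apply hall_split_in _ _ x
        · intro A hA
          by_contra hxA
          have h1 := reach_le_card hnl (reach_cons_notMem hxA (hr A hA))
          have := (mem_powersetCard.1 (hX hA)).2
          omega
        · rw [hUe]; exact hlkh 0 hab hle
      · apply hall_split _ _ x hxU
        · rw [hUe]
          apply ih hnl a b (h + 2) _ hdel (by omega) (by omega)
          intro A hA
          rw [mem_filter] at hA
          exact reach_cons_notMem hA.2 (hr A hA.1)
        · rw [hUe]; exact hlkh (b + 1) hab hle

/-- shadow version of `hall_walk`. -/
lemma shadow_walk (l : List ℕ) (hn : l.Nodup) (a : ℕ) (X : Finset (Finset ℕ))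
    (hX : X ⊆ powersetCard a l.toFinset) (hr : ∀ A ∈ X, Reach l 1 A)
    (hal : 2 * a ≤ l.length + 1) :
    X.card ≤ (Sh (a - 1) X).card := by
  by_cases hX0 : X = ∅
  · simp [hX0]
  obtain ⟨A0, hA0⟩ := nonempty_iff_ne_empty.2 hX0
  have ha1 : 1 ≤ a := by
    have := reach_le_card hn (hr A0 hA0)
    rwa [(mem_powersetCard.1 (hX hA0)).2] at this
  have hlc : l.toFinset.card = l.length := List.toFinset_card_of_nodup hn
  have hrev : l.reverse.toFinset = l.toFinset := List.toFinset_reverse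
  have h1 := cpl_subset hX
  have h2 : cpl l.toFinset (cpl l.toFinset X) = X := by
    unfold cpl
    rw [image_image]
    conv_rhs => rw [← image_id (s := X)]
    apply image_congr
    intro A hA
    have hA' := (mem_powersetCard.1 (hX (mem_coe.1 hA))).1
    simp [hA']
  rw [← card_cpl hX]
  conv_rhs => rw [← h2]
  rw [← NQ_eq_Sh_cpl (a - 1), ← hrev]
  rw [hlc, ← hrev] at h1
  have hal' : a ≤ l.length := by omega
  apply hall_walk l.reverse (List.nodup_reverse.2 hn) (l.length - a) (a - 1) (l.length + 1 - 2 * a)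
    _ h1 (by simp; omega) (by omega)
  intro C hC
  rw [hrev] at hC
  obtain ⟨A, hA, rfl⟩ := mem_image.1 hC
  obtain ⟨l1, l2, rfl, hh⟩ := hr A hA
  obtain ⟨hA1, hA2⟩ := mem_powersetCard.1 (hX hA)
  refine ⟨l2.reverse, l1.reverse, by simp, ?_⟩
  have e1 : (l2.reverse.filter (fun y => y ∈ (l1 ++ l2).toFinset \ A)).length
      = (l2.filter (fun y => ¬ (y ∈ A))).length := by
    rw [List.filter_reverse, List.length_reverse]
    congr 1
    apply List.filter_congr
    intro z hz
    simp [hz]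
  have e2 : (l2.filter (fun y => y ∈ A)).length + (l2.filter (fun y => ¬ (y ∈ A))).length
      = l2.length := by
    have := List.length_eq_length_filter_add (l := l2) (fun y => decide (y ∈ A))
    simp only [decide_not] at this ⊢
    omega
  have e3 : ((l1 ++ l2).filter (fun y => y ∈ A)).length = a := by
    rw [← hA2, ← List.toFinset_card_of_nodup (hn.filter _)]
    congr 1
    ext y
    simp only [List.mem_toFinset, List.mem_filter, decide_eq_true_eq]
    constructor
    · exact fun h => h.2
    · intro h
      exact ⟨List.mem_toFinset.1 (hA1 h), h⟩
  rw [List.filter_append, List.length_append] at e3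
  rw [e1]
  simp only [List.length_reverse, List.length_append]
  simp only [List.length_append] at hal hal'
  omega

end Part3

section Part4
open Finset

lemma cross_bound (U : Finset ℕ) (b : ℕ) (Q : Finset ℕ → Prop) (X G : Finset (Finset ℕ))
    (hG : G ⊆ powersetCard b U) (hc : ∀ A ∈ X, ∀ B ∈ G, ¬ Disjoint A B) :
    G.card + (NQ U b Q X).card ≤ U.card.choose b := by
  rw [← card_powersetCard, ← card_union_of_disjoint]
  · apply card_le_card
    apply union_subset hG
    intro B hB
    rw [mem_NQ] at hB
    exact mem_powersetCard.2 hB.1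
  · rw [disjoint_left]
    intro B hB hB2
    rw [mem_NQ] at hB2
    obtain ⟨_, _, A, hA, hd⟩ := hB2
    exact hc A hA B hB hd

lemma cross_gen (U : Finset ℕ) (N c a : ℕ) (X G : Finset (Finset ℕ)) (hN : 2 * c + 3 ≤ N)
    (hX : X ⊆ powersetCard a U) (hU : U.card + c = N + a) (ha : c ≤ a)
    (hG : G ⊆ powersetCard (c + 2) U)
    (hc : ∀ A ∈ X, ∀ B ∈ G, ¬ Disjoint A B)
    (h1 : N.choose c ≤ X.card) (h2 : X.card ≤ (N + 1).choose (c + 1)) :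
    X.card + G.card + N.choose (c + 2) ≤ U.card.choose (c + 2) + N.choose c := by
  have hr : U.card - a = N - c := by omega
  have e1 : N.choose (N - c) = N.choose c := Nat.choose_symm (by omega)
  have e2 : (N + 1).choose (N - c) = (N + 1).choose (c + 1) := by
    rw [← Nat.choose_symm (n := N + 1) (k := c + 1) (by omega)]
    congr 1; omega
  have hX' := cpl_subset hX
  rw [hr] at hX'
  have k1 := kk_gen U (N - c) (c + 2) N (cpl U X) hX' (by omega) (by omega) (by omega) (by omega)
    (by rw [card_cpl hX, e1]; exact h1) (by rw [card_cpl hX, e2]; exact h2)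
  rw [card_cpl hX, ← NQ_eq_Sh_cpl, e1] at k1
  have k2 := cross_bound U (c + 2) (fun _ => True) X G hG hc
  omega

lemma pascal_facts (N c : ℕ) :
    (N + 3).choose (c + 2) = (N + 2).choose (c + 1) + (N + 2).choose (c + 2) ∧
    (N + 2).choose (c + 2) = (N + 1).choose (c + 1) + (N + 1).choose (c + 2) ∧
    (N + 1).choose (c + 2) = N.choose (c + 1) + N.choose (c + 2) ∧
    (N + 1).choose (c + 1) = N.choose c + N.choose (c + 1) :=
  ⟨Nat.choose_succ_succ _ _, Nat.choose_succ_succ _ _, Nat.choose_succ_succ _ _,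
    Nat.choose_succ_succ _ _⟩

lemma choose_mono_fact (N c : ℕ) (hN : 2 * c + 3 ≤ N) : N.choose c ≤ N.choose (c + 1) :=
  Nat.choose_le_succ_of_lt_half_left (by omega)

lemma cross_pair (U : Finset ℕ) (N c : ℕ) (H G : Finset (Finset ℕ)) (hN : 2 * c + 3 ≤ N)
    (hU : U.card = N + 2)
    (hH : H ⊆ powersetCard (c + 2) U) (hG : G ⊆ powersetCard (c + 2) U)
    (hc : ∀ A ∈ H, ∀ B ∈ G, ¬ Disjoint A B)
    (h1 : N.choose c ≤ H.card) (h2 : N.choose c ≤ G.card) :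
    H.card + G.card ≤ 2 * (N + 1).choose (c + 1) := by
  obtain ⟨p1, p2, p3, p4⟩ := pascal_facts N c
  by_cases hH2 : H.card ≤ (N + 1).choose (c + 1)
  · have := cross_gen U N c (c + 2) H G hN hH (by omega) (by omega) hG hc h1 hH2
    rw [hU] at this
    omega
  by_cases hG2 : G.card ≤ (N + 1).choose (c + 1)
  · have := cross_gen U N c (c + 2) G H hN hG (by omega) (by omega) hH
      (fun A hA B hB hd => hc B hB A hA hd.symm) h2 hG2
    rw [hU] at this
    omega
  obtain ⟨H', hH', hHc⟩ := exists_subset_card_eq (s := H) (n := (N + 1).choose (c + 1)) (by omega)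
  have := cross_gen U N c (c + 2) H' G hN (hH'.trans hH) (by omega) (by omega) hG
    (fun A hA B hB => hc A (hH' hA) B hB) (by omega) (by omega)
  rw [hU] at this
  omega

/-- A large family of large diversity (to be shown not to exist). -/
structure Bad (N c : ℕ) (F : Finset (Finset ℕ)) : Prop where
  sub : F ⊆ powersetCard (c + 3) (Icc 1 (N + 4))
  int : Intersecting F
  big : (N + 3).choose (c + 2) + N.choose c < F.card + N.choose (c + 2)
  dv : ∀ i ∈ Icc 1 (N + 4), N.choose c ≤ (F.filter (fun A => i ∉ A)).card

lemma inter_not_disjoint {F : Finset (Finset ℕ)} (h : Intersecting F) {A B : Finset ℕ}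
    (hA : A ∈ F) (hB : B ∈ F) : ¬ Disjoint A B := by
  rw [disjoint_iff_inter_eq_empty]
  exact (h A hA B hB).ne_empty

lemma bad1 {N c : ℕ} {F : Finset (Finset ℕ)} (hN : 2 * c + 3 ≤ N) (hF : Bad N c F) {i : ℕ}
    (hi : i ∈ Icc 1 (N + 4)) : (N + 1).choose (c + 1) < (F.filter (fun A => i ∉ A)).card := by
  by_contra hcon
  have hUc : ((Icc 1 (N + 4)).erase i).card = N + 3 := by
    rw [card_erase_of_mem hi]; simp
  have := cross_gen ((Icc 1 (N + 4)).erase i) N c (c + 3) (F.filter (fun A => i ∉ A)) (lk i F) hN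
    (del_subset hF.sub) (by omega) (by omega) (lk_subset hF.sub)
    (by
      intro A hA B hB hd
      rw [mem_filter] at hA
      rw [mem_lk] at hB
      apply inter_not_disjoint hF.int hA.1 hB.2
      rw [disjoint_insert_right]; exact ⟨hA.2, hd⟩)
    (hF.dv i hi) (by omega)
  have h2 := card_lk_add i F
  have h3 := hF.big
  rw [hUc] at this
  omega

/-- decomposition relative to a pair of points -/
lemma pair_counts (F : Finset (Finset ℕ)) {i j : ℕ} (hij : i ≠ j) :
    (F.filter (fun A => i ∉ A)).card =
      ((F.filter (fun A => i ∉ A)).filter (fun A => j ∉ A)).card +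
        (lk j (F.filter (fun A => i ∉ A))).card ∧
    (F.filter (fun A => j ∉ A)).card =
      ((F.filter (fun A => i ∉ A)).filter (fun A => j ∉ A)).card +
        ((lk i F).filter (fun A => j ∉ A)).card ∧
    F.card = ((F.filter (fun A => i ∉ A)).filter (fun A => j ∉ A)).card +
        (lk j (F.filter (fun A => i ∉ A))).card + ((lk i F).filter (fun A => j ∉ A)).card +
        (lk j (lk i F)).card := by
  have h1 := card_lk_add j (F.filter (fun A => i ∉ A))
  have h2 := card_lk_add i (F.filter (fun A => j ∉ A))
  have h3 := card_lk_add i F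
  have h4 := card_lk_add j (lk i F)
  have h5 : (F.filter (fun A => j ∉ A)).filter (fun A => i ∉ A) =
      (F.filter (fun A => i ∉ A)).filter (fun A => j ∉ A) := filter_comm ..
  have h6 : lk i (F.filter (fun A => j ∉ A)) = (lk i F).filter (fun A => j ∉ A) := by
    ext A
    simp only [mem_lk, mem_filter, mem_insert, not_or]
    have : j ≠ i := hij.symm
    tauto
  rw [h5, h6] at h2
  refine ⟨h1, h2, by omega⟩

lemma pair_lemma {N c : ℕ} {F : Finset (Finset ℕ)} (hN : 2 * c + 3 ≤ N) (hF : Bad N c F) {i j : ℕ}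
    (hi : i ∈ Icc 1 (N + 4)) (hj : j ∈ Icc 1 (N + 4)) (hij : i ≠ j)
    (hH : N.choose c ≤ (lk j (F.filter (fun A => i ∉ A))).card)
    (hG : N.choose c ≤ ((lk i F).filter (fun A => j ∉ A)).card)
    (hDE : ((F.filter (fun A => i ∉ A)).filter (fun A => j ∉ A)).card ≤
      (NQ (((Icc 1 (N + 4)).erase i).erase j) (c + 1) (fun _ => True)
        ((F.filter (fun A => i ∉ A)).filter (fun A => j ∉ A))).card) : False := by
  have hWc : (((Icc 1 (N + 4)).erase i).erase j).card = N + 2 := by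
    rw [card_erase_of_mem (mem_erase.2 ⟨hij.symm, hj⟩), card_erase_of_mem hi]; simp
  have h1 := cross_pair (((Icc 1 (N + 4)).erase i).erase j) N c _ _ hN hWc
    (lk_subset (del_subset hF.sub)) (del_subset (lk_subset hF.sub))
    (by
      intro A hA B hB hd
      rw [mem_lk, mem_filter] at hA
      rw [mem_filter, mem_lk] at hB
      apply inter_not_disjoint hF.int hA.2.1 hB.1.2
      rw [disjoint_insert_right, disjoint_insert_left]
      exact ⟨hA.2.2, hB.2, hd⟩) hH hG
  have h2 := cross_bound (((Icc 1 (N + 4)).erase i).erase j) (c + 1) (fun _ => True)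
    ((F.filter (fun A => i ∉ A)).filter (fun A => j ∉ A)) (lk j (lk i F))
    (lk_subset (lk_subset hF.sub))
    (by
      intro A hA B hB hd
      rw [mem_filter, mem_filter] at hA
      rw [mem_lk, mem_lk] at hB
      apply inter_not_disjoint hF.int hA.1.1 hB.2.2
      rw [disjoint_insert_right, disjoint_insert_right]
      exact ⟨hA.1.2, hA.2, hd⟩)
  rw [hWc] at h2
  obtain ⟨_, _, h3⟩ := pair_counts F hij
  obtain ⟨p1, p2, p3, p4⟩ := pascal_facts N c
  have h4 := hF.big
  omega

lemma bad2 {N c : ℕ} {F : Finset (Finset ℕ)} (hN : 2 * c + 3 ≤ N) (hF : Bad N c F) {i j : ℕ}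
    (hi : i ∈ Icc 1 (N + 4)) (hj : j ∈ Icc 1 (N + 4)) (hij : i ≠ j) :
    N.choose (c + 1) < ((F.filter (fun A => i ∉ A)).filter (fun A => j ∉ A)).card := by
  by_contra hcon
  have hWc : (((Icc 1 (N + 4)).erase i).erase j).card = N + 2 := by
    rw [card_erase_of_mem (mem_erase.2 ⟨hij.symm, hj⟩), card_erase_of_mem hi]; simp
  obtain ⟨h1, h2, h3⟩ := pair_counts F hij
  have b1 := bad1 hN hF hi
  have b2 := bad1 hN hF hj
  obtain ⟨p1, p2, p3, p4⟩ := pascal_facts N c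
  apply pair_lemma hN hF hi hj hij (by omega) (by omega)
  apply hall_kk _ (c + 3) (c + 1) N _ (del_subset (del_subset hF.sub)) _ (fun _ => trivial)
    (by omega) (by omega)
  rw [hWc]
  have : N.choose (N + 2 - (c + 3)) = N.choose (c + 1) := by
    rw [← Nat.choose_symm (n := N) (k := c + 1) (by omega)]
    congr 1; omega
  omega

/-- swap `j` for `i` -/
def sw (i j : ℕ) (A : Finset ℕ) : Finset ℕ := insert i (A.erase j)

/-- the shift map relative to `F` -/
def shf (i j : ℕ) (F : Finset (Finset ℕ)) (A : Finset ℕ) : Finset ℕ :=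
  if j ∈ A ∧ i ∉ A ∧ sw i j A ∉ F then sw i j A else A

lemma sw_sw {i j : ℕ} {A : Finset ℕ} (hj : j ∈ A) (hi : i ∉ A) : sw j i (sw i j A) = A := by
  unfold sw
  rw [erase_insert (by simp [hi]), insert_erase hj]

lemma shf_inj (i j : ℕ) (F : Finset (Finset ℕ)) : Set.InjOn (shf i j F) F := by
  intro A hA B hB h
  rw [mem_coe] at hA hB
  unfold shf at h
  split_ifs at h with h1 h2 h2
  · rw [← sw_sw h1.1 h1.2.1, ← sw_sw h2.1 h2.2.1, h]
  · exact absurd (h ▸ hB) h1.2.2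
  · exact absurd (h ▸ hA) h2.2.2
  · exact h

lemma shf_int {i j : ℕ} (hij : i ≠ j) {F : Finset (Finset ℕ)} (hF : Intersecting F) :
    Intersecting (F.image (shf i j F)) := by
  have key : ∀ A ∈ F, ∀ B ∈ F, ¬ (j ∈ A ∧ i ∉ A ∧ sw i j A ∉ F) →
      (j ∈ B ∧ i ∉ B ∧ sw i j B ∉ F) → (A ∩ sw i j B).Nonempty := by
    intro A hA B hB h1 h2
    by_cases hiA : i ∈ A
    · exact ⟨i, by simp [hiA, sw]⟩
    by_cases hjA : j ∈ A
    · have : sw i j A ∈ F := by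
        by_contra h; exact h1 ⟨hjA, hiA, h⟩
      obtain ⟨y, hy⟩ := hF _ this B hB
      rw [mem_inter] at hy
      have hyi : y ≠ i := by rintro rfl; exact h2.2.1 hy.2
      have := hy.1
      simp only [sw, mem_insert, hyi, mem_erase, false_or] at this
      exact ⟨y, by simp [sw, this.1, this.2, hy.2]⟩
    · obtain ⟨y, hy⟩ := hF A hA B hB
      rw [mem_inter] at hy
      have hyj : y ≠ j := by rintro rfl; exact hjA hy.1
      exact ⟨y, by simp [sw, hyj, hy.1, hy.2]⟩
  intro A' hA' B' hB'
  obtain ⟨A, hA, rfl⟩ := mem_image.1 hA'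
  obtain ⟨B, hB, rfl⟩ := mem_image.1 hB'
  unfold shf
  split_ifs with h1 h2 h2
  · exact ⟨i, by simp [sw]⟩
  · rw [inter_comm]; exact key B hB A hA h2 h1
  · exact key A hA B hB h1 h2
  · exact hF A hA B hB

lemma bad3 {N c : ℕ} {F : Finset (Finset ℕ)} (hN : 2 * c + 3 ≤ N) (hF : Bad N c F) {i j : ℕ}
    (hi : i ∈ Icc 1 (N + 4)) (hj : j ∈ Icc 1 (N + 4)) (hij : i ≠ j) :
    Bad N c (F.image (shf i j F)) := by
  refine ⟨?_, shf_int hij hF.int, ?_, ?_⟩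
  · intro A' hA'
    obtain ⟨A, hA, rfl⟩ := mem_image.1 hA'
    have hA2 := mem_powersetCard.1 (hF.sub hA)
    unfold shf
    split_ifs with h
    · rw [mem_powersetCard]
      refine ⟨insert_subset hi ((erase_subset _ _).trans hA2.1), ?_⟩
      unfold sw
      rw [card_insert_of_notMem (by simp [h.2.1]), card_erase_add_one h.1, hA2.2]
    · exact hF.sub hA
  · rw [card_image_of_injOn (shf_inj i j F)]; exact hF.big
  · intro l hl
    have hs : (F.filter (fun A => j ∉ A)).filter (fun A => l ∉ A) ⊆
        (F.image (shf i j F)).filter (fun A => l ∉ A) := by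
      intro A hA
      rw [mem_filter, mem_filter] at hA
      rw [mem_filter, mem_image]
      exact ⟨⟨A, hA.1.1, by simp [shf, hA.1.2]⟩, hA.2⟩
    refine le_trans ?_ (card_le_card hs)
    by_cases hlj : j = l
    · subst hlj
      rw [filter_filter]
      simpa using hF.dv j hj
    · have := bad2 hN hF hj hl hlj
      have := choose_mono_fact N c hN
      omega

lemma shf_sum {i j : ℕ} (hij : i < j) (F : Finset (Finset ℕ)) (A : Finset ℕ) (hA : A ∈ F)
    (hm : j ∈ A ∧ i ∉ A ∧ sw i j A ∉ F) :
    ∑ B ∈ F.image (shf i j F), ∑ x ∈ B, x < ∑ B ∈ F, ∑ x ∈ B, x := by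
  rw [sum_image (shf_inj i j F)]
  have hlt : ∀ B, (j ∈ B ∧ i ∉ B ∧ sw i j B ∉ F) → ∑ x ∈ sw i j B, x < ∑ x ∈ B, x := by
    intro B hB
    unfold sw
    rw [sum_insert (by simp [hB.2.1]), ← add_sum_erase B (fun x => x) hB.1]
    omega
  apply sum_lt_sum
  · intro B _
    unfold shf
    split_ifs with h
    · exact (hlt B h).le
    · exact le_rfl
  · refine ⟨A, hA, ?_⟩
    unfold shf
    rw [if_pos hm]
    exact hlt A hm

lemma exists_shifted {N c : ℕ} (hN : 2 * c + 3 ≤ N) (s : ℕ) : ∀ F, Bad N c F →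
    ∑ B ∈ F, ∑ x ∈ B, x ≤ s → ∃ F, Bad N c F ∧ ∀ i ∈ Icc 1 (N + 4), ∀ j ∈ Icc 1 (N + 4), i < j →
      ∀ A ∈ F, j ∈ A → i ∉ A → sw i j A ∈ F := by
  induction s with
  | zero =>
    intro F hF hs
    refine ⟨F, hF, ?_⟩
    intro i hi j hj hij A hA hjA hiA
    by_contra h
    have := shf_sum hij F A hA ⟨hjA, hiA, h⟩
    omega
  | succ s ih =>
    intro F hF hs
    by_cases h : ∀ i ∈ Icc 1 (N + 4), ∀ j ∈ Icc 1 (N + 4), i < j →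
      ∀ A ∈ F, j ∈ A → i ∉ A → sw i j A ∈ F
    · exact ⟨F, hF, h⟩
    · push Not at h
      obtain ⟨i, hi, j, hj, hij, A, hA, hjA, hiA, hn⟩ := h
      have := shf_sum hij F A hA ⟨hjA, hiA, hn⟩
      exact ih _ (bad3 hN hF hi hj hij.ne) (by omega)

end Part4

section Part5
open Finset

lemma shifted_walk {n k : ℕ} {F : Finset (Finset ℕ)} (hF : F ⊆ powersetCard k (Icc 1 n))
    (hint : Intersecting F)
    (hs : ∀ i ∈ Icc 1 n, ∀ j ∈ Icc 1 n, i < j → ∀ A ∈ F, j ∈ A → i ∉ A → sw i j A ∈ F)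
    {A : Finset ℕ} (hA : A ∈ F) : ∃ z ∈ A, z ≤ 2 * (A.filter (fun y => y ≤ z)).card := by
  by_contra! hcon
  have hAc := mem_powersetCard.1 (hF hA)
  have key : ∀ z, ∃ A' ∈ F, (∀ y, z ≤ y → (y ∈ A' ↔ y ∈ A)) ∧ (∀ y, y < z → y ∈ A → y ∉ A') := by
    intro z
    induction z with
    | zero => exact ⟨A, hA, fun _ _ => Iff.rfl, fun y hy => by omega⟩
    | succ z ih =>
      obtain ⟨A', hA', h1, h2⟩ := ih
      by_cases hz : z ∈ A
      · have hz' : z ∈ A' := (h1 z le_rfl).2 hz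
        have hzn := hAc.1 hz
        have hA'c := mem_powersetCard.1 (hF hA')
        have c0 := hcon z hz
        have c1 : (A.filter (fun y => y ≤ z)).card = (A.filter (fun y => y < z)).card + 1 := by
          have : A.filter (fun y => y ≤ z) = insert z (A.filter (fun y => y < z)) := by
            ext y
            simp only [mem_filter, mem_insert]
            constructor
            · rintro ⟨a, b⟩
              rcases b.lt_or_eq with h | h
              · exact Or.inr ⟨a, h⟩
              · exact Or.inl h
            · rintro (rfl | ⟨a, b⟩)
              · exact ⟨hz, le_rfl⟩
              · exact ⟨a, b.le⟩
          rw [this, card_insert_of_notMem (by simp)]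
        have c2 : (A'.filter (fun y => y < z)).card = (A.filter (fun y => y < z)).card := by
          have e1 := card_filter_add_card_filter_not (s := A) (fun y => y < z)
          have e2 := card_filter_add_card_filter_not (s := A') (fun y => y < z)
          have e3 : A'.filter (fun y => ¬ y < z) = A.filter (fun y => ¬ y < z) := by
            ext y
            simp only [mem_filter, not_lt]
            constructor
            · rintro ⟨a, b⟩
              exact ⟨(h1 y b).1 a, b⟩
            · rintro ⟨a, b⟩
              exact ⟨(h1 y b).2 a, b⟩
          rw [e3] at e2
          omega
        have c3 : ((A.filter (fun y => y < z)) ∪ (A'.filter (fun y => y < z))).card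
            < (Icc 1 (z - 1)).card := by
          have := card_union_le (A.filter (fun y => y < z)) (A'.filter (fun y => y < z))
          simp only [Nat.card_Icc]
          omega
        obtain ⟨u, hu, hu2⟩ := exists_mem_notMem_of_card_lt_card c3
        simp only [mem_union, mem_filter, not_or, not_and, mem_Icc] at hu hu2 hzn
        have huz : u < z := by omega
        have hu3 : u ∉ A := fun h => hu2.1 h huz
        have hu4 : u ∉ A' := fun h => hu2.2 h huz
        refine ⟨sw u z A', hs u (by simp; omega) z (by simp; omega) huz A' hA' hz' hu4, ?_, ?_⟩
        · intro y hy
          have := h1 y (by omega)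
          simp only [sw, mem_insert, mem_erase]
          constructor
          · rintro (h | h)
            · omega
            · exact this.1 h.2
          · intro h
            exact Or.inr ⟨by omega, this.2 h⟩
        · intro y hy hyA
          simp only [sw, mem_insert, mem_erase, not_or, not_and]
          refine ⟨fun h => hu3 (h ▸ hyA), fun h => h2 y (by omega) hyA⟩
      · refine ⟨A', hA', fun y hy => h1 y (by omega), fun y hy hyA => ?_⟩
        have : y ≠ z := fun h => hz (h ▸ hyA)
        exact h2 y (by omega) hyA
  obtain ⟨A', hA', _, h2⟩ := key (n + 1)
  apply inter_not_disjoint hint hA hA'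
  rw [disjoint_left]
  intro y hy
  have := hAc.1 hy
  rw [mem_Icc] at this
  exact h2 y (by omega) hy

lemma no_bad {N c : ℕ} {F : Finset (Finset ℕ)} (hN : 2 * c + 3 ≤ N) (hF0 : Bad N c F) : False := by
  obtain ⟨F, hF, hs⟩ := exists_shifted hN _ F hF0 le_rfl
  clear hF0
  set D := (F.filter (fun A => 1 ∉ A)).filter (fun A => 2 ∉ A) with hD
  set l := List.range' 3 (N + 2) with hl
  have hnd : l.Nodup := List.nodup_range'
  have hll : l.length = N + 2 := by simp [hl]
  have hlf : l.toFinset = ((Icc 1 (N + 4)).erase 1).erase 2 := by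
    ext x
    simp only [hl, List.mem_toFinset, List.mem_range'_1, mem_erase, mem_Icc]
    omega
  have hDs : D ⊆ powersetCard (c + 3) l.toFinset := by
    rw [hlf]
    exact del_subset (del_subset hF.sub)
  have hreach : ∀ A ∈ D, Reach l 2 A := by
    intro A hA
    have hAF : A ∈ F := by
      simp only [hD, mem_filter] at hA
      exact hA.1.1
    have hAs := (mem_powersetCard.1 (hDs hA)).1
    obtain ⟨z, hz, hz2⟩ := shifted_walk hF.sub hF.int hs hAF
    have hzl := hAs hz
    simp only [hl, List.mem_toFinset, List.mem_range'_1] at hzl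
    refine ⟨List.range' 3 (z - 2), List.range' (3 + (z - 2)) (N + 2 - (z - 2)), ?_, ?_⟩
    · rw [List.range'_append_1, hl]
      congr 1
      omega
    · have : (A.filter (fun y => y ≤ z)).card =
          ((List.range' 3 (z - 2)).filter (fun y => y ∈ A)).length := by
        rw [← List.toFinset_card_of_nodup (List.Nodup.filter _ List.nodup_range')]
        congr 1
        ext y
        simp only [mem_filter, List.toFinset_filter, List.mem_toFinset, List.mem_range'_1, decide_eq_true_eq]
        constructor
        · rintro ⟨a, b⟩
          have := hAs a
          simp only [hl, List.mem_toFinset, List.mem_range'_1] at this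
          exact ⟨by omega, a⟩
        · rintro ⟨a, b⟩
          exact ⟨b, by omega⟩
      rw [List.length_range']
      omega
  have hreach1 : ∀ A ∈ D, Reach l 1 A := by
    intro A hA
    obtain ⟨l1, l2, e, h⟩ := hreach A hA
    exact ⟨l1, l2, e, by omega⟩
  have hDE := hall_walk l hnd (c + 3) (c + 1) 2 D hDs (by omega) (by omega) hreach
  have hSh := shadow_walk l hnd (c + 3) D hDs hreach1 (by omega)
  have h12 : (1 : ℕ) ∈ Icc 1 (N + 4) := by simp
  have h22 : (2 : ℕ) ∈ Icc 1 (N + 4) := by simp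
  have hSH : Sh (c + 3 - 1) D ⊆ lk 2 (F.filter (fun A => 1 ∉ A)) := by
    intro B hB
    obtain ⟨A, hA, hBA, hBc⟩ := mem_Sh.1 hB
    have hAc := mem_powersetCard.1 (hDs hA)
    simp only [hD, mem_filter] at hA
    obtain ⟨z, hz, hzB⟩ := exists_mem_notMem_of_card_lt_card (s := B) (t := A) (by omega)
    have hzl := hAc.1 hz
    simp only [hl, List.mem_toFinset, List.mem_range'_1] at hzl
    have hAz : A.erase z = B := by
      symm
      apply eq_of_subset_of_card_le
      · intro x hx
        rw [mem_erase]
        exact ⟨fun h => hzB (h ▸ hx), hBA hx⟩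
      · rw [card_erase_of_mem hz]
        omega
    have := hs 2 h22 z (by simp; omega) (by omega) A hA.1.1 hz hA.2
    rw [sw, hAz] at this
    rw [mem_lk, mem_filter]
    refine ⟨fun h => hA.2 (hBA h), this, ?_⟩
    rw [mem_insert]
    rintro (h | h)
    · omega
    · exact hA.1.2 (hBA h)
  have hHG : lk 2 (F.filter (fun A => 1 ∉ A)) ⊆ (lk 1 F).filter (fun A => 2 ∉ A) := by
    intro B hB
    rw [mem_lk, mem_filter] at hB
    obtain ⟨h1, h2, h3⟩ := hB
    have := hs 1 h12 2 h22 (by omega) _ h2 (by simp) h3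
    rw [sw, erase_insert h1] at this
    rw [mem_filter, mem_lk]
    exact ⟨⟨fun h => h3 (by simp [h]), this⟩, h1⟩
  have q1 := card_le_card hSH
  have q2 := card_le_card hHG
  obtain ⟨r1, r2, r3⟩ := pair_counts F (i := 1) (j := 2) (by omega)
  rw [← hD] at r1 r2 r3
  have b1 := bad1 hN hF h12
  obtain ⟨p1, p2, p3, p4⟩ := pascal_facts N c
  have p5 := choose_mono_fact N c hN
  refine pair_lemma hN hF h12 h22 (by omega) (by omega) (by omega) ?_
  rw [hlf] at hDE
  exact hDE

end Part5

section Part6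
open Finset

/-- `B` meets every member of `M`. -/
def Hit (M : Finset (Finset ℕ)) (B : Finset ℕ) : Prop := ∀ S ∈ M, (B ∩ S).Nonempty

lemma hall_min {N c : ℕ} (hN : 2 * c + 3 ≤ N) {M : Finset (Finset ℕ)} {Y : Finset ℕ}
    (hM : M ⊆ powersetCard (c + 3) ((Icc 1 (N + 4)).erase 1))
    (hmin : MinimalWrtCommonInt (N + 4) M) (hY : Y ⊆ famInter (N + 4) M) (hY1 : 1 ∉ Y)
    (hYc : Y.card = 3) (X : Finset (Finset ℕ))
    (hX : X ⊆ powersetCard c (((Icc 1 (N + 4)).erase 1) \ Y)) (hXM : ∀ A ∈ X, A ∪ Y ∉ M) :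
    X.card ≤ (NQ (((Icc 1 (N + 4)).erase 1) \ Y) (c + 2) (Hit M) X).card := by
  set V := (Icc 1 (N + 4)).erase 1 with hV
  have hVc : V.card = N + 3 := by simp [hV]
  have hYV : Y ⊆ V := by
    intro y hy
    have h := hY hy
    rw [famInter, mem_filter] at h
    exact mem_erase.2 ⟨fun e => hY1 (e ▸ hy), h.1⟩
  have hUc : (V \ Y).card = N := by
    rw [card_sdiff_of_subset hYV]
    omega
  have hYS : ∀ S ∈ M, Y ⊆ S := by
    intro S hS y hy
    have h := hY hy
    rw [famInter, mem_filter] at h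
    exact h.2 S hS
  have hz : ∀ A S, ∃ z, A ∈ X → S ∈ M → z ∈ (V \ Y) \ A ∧ z ∈ S := by
    intro A S
    by_cases hA : A ∈ X
    · by_cases hS : S ∈ M
      · have hAc := mem_powersetCard.1 (hX hA)
        have hSc := mem_powersetCard.1 (hM hS)
        have hlt : ¬ (S \ Y ⊆ A) := by
          intro h
          have h1 : S \ Y = A := by
            apply eq_of_subset_of_card_le h
            rw [card_sdiff_of_subset (hYS S hS)]
            omega
          apply hXM A hA
          rw [← h1, sdiff_union_of_subset (hYS S hS)]
          exact hS
        obtain ⟨z, hz1, hz2⟩ := not_subset.1 hlt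
        rw [mem_sdiff] at hz1
        exact ⟨z, fun _ _ => ⟨by simp only [mem_sdiff]; exact ⟨⟨hSc.1 hz1.1, hz1.2⟩, hz2⟩, hz1.1⟩⟩
      · exact ⟨0, fun _ h => absurd h hS⟩
    · exact ⟨0, fun h => absurd h hA⟩
  choose z hz using hz
  have hRz : ∀ A ∈ X, M.image (z A) ⊆ (V \ Y) \ A ∧ (M.image (z A)).card ≤ M.card ∧
      ∀ B, M.image (z A) ⊆ B → Hit M B := by
    intro A hA
    refine ⟨?_, card_image_le, ?_⟩
    · intro y hy
      obtain ⟨S, hS, rfl⟩ := mem_image.1 hy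
      exact (hz A S hA hS).1
    · intro B hB S hS
      exact ⟨z A S, mem_inter.2 ⟨hB (mem_image_of_mem _ hS), (hz A S hA hS).2⟩⟩
  by_cases hM1 : M.card ≤ 1
  · apply hall_witness ∅ (V \ Y) c (c + 2) (Hit M) X hX (by omega) (by omega) (by simp)
    · intro A hA x hx
      simp at hx
    · intro A hA _
      obtain ⟨h1, h2, h3⟩ := hRz A hA
      exact ⟨_, h1, by simp; omega, fun B _ h _ => h3 B h⟩
  · have hx : ∀ S, ∃ x, S ∈ M → x ∈ V \ Y ∧ x ∉ S ∧ ∀ T ∈ M, T ≠ S → x ∈ T := by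
      intro S
      by_cases hS : S ∈ M
      · obtain ⟨x, hx1, hx2⟩ := exists_mem_notMem_of_card_lt_card (hmin S hS)
        simp only [famInter, mem_filter, mem_erase, not_and] at hx1 hx2
        have h3 : ∀ T ∈ M, T ≠ S → x ∈ T := fun T hT hne => hx1.2 T ⟨hne, hT⟩
        have h4 : x ∉ S := by
          intro hxS
          apply hx2 hx1.1
          intro T hT
          by_cases e : T = S
          · exact e ▸ hxS
          · exact h3 T hT e
        refine ⟨x, fun _ => ⟨?_, h4, h3⟩⟩
        obtain ⟨T, hT, hTS⟩ := exists_mem_ne (by omega : 1 < M.card) S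
        rw [mem_sdiff]
        exact ⟨(mem_powersetCard.1 (hM hT)).1 (h3 T hT hTS), fun h => h4 (hYS S hS h)⟩
      · exact ⟨0, fun h => absurd h hS⟩
    choose x hx using hx
    have hinj : Set.InjOn x M := by
      intro S hS T hT e
      by_contra hne
      have h1 := (hx S hS).2.2 T hT (fun h => hne h.symm)
      rw [e] at h1
      exact (hx T hT).2.1 h1
    apply hall_witness (M.image x) (V \ Y) c (c + 2) (Hit M) X hX (by omega) (by omega)
    · intro y hy
      obtain ⟨S, hS, rfl⟩ := mem_image.1 hy
      exact (hx S hS).1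
    · intro A hA y hy hyA
      obtain ⟨S, hS, rfl⟩ := mem_image.1 hy
      refine ⟨{x S, z A S}, ?_, by simp, ?_, ?_⟩
      · intro w hw
        simp only [mem_insert, mem_singleton] at hw
        rcases hw with rfl | rfl
        · exact mem_sdiff.2 ⟨(hx S hS).1, hyA⟩
        · exact (hz A S hA hS).1
      · have := card_le_two (a := x S) (b := z A S)
        omega
      · intro B _ hRB _ T hT
        by_cases e : T = S
        · subst e
          exact ⟨z A T, mem_inter.2 ⟨hRB (by simp), (hz A T hA hT).2⟩⟩
        · exact ⟨x S, mem_inter.2 ⟨hRB (by simp), (hx S hS).2.2 T hT e⟩⟩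
    · intro A hA _
      obtain ⟨h1, h2, h3⟩ := hRz A hA
      refine ⟨_, h1, ?_, fun B _ h _ => h3 B h⟩
      rw [card_image_of_injOn hinj]
      omega

end Part6

section Part7
open Finset

lemma hall_full {N c : ℕ} (hN : 2 * c + 3 ≤ N) {M : Finset (Finset ℕ)} {Y : Finset ℕ}
    (hM : M ⊆ powersetCard (c + 3) ((Icc 1 (N + 4)).erase 1))
    (hmin : MinimalWrtCommonInt (N + 4) M) (hY : Y ⊆ famInter (N + 4) M) (hY1 : 1 ∉ Y)
    (hYc : Y.card = 3) (X : Finset (Finset ℕ))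
    (hX : X ⊆ powersetCard (c + 3) ((Icc 1 (N + 4)).erase 1)) (hXM : ∀ A ∈ X, A ∉ M)
    (hXc : X.card ≤ N.choose c) :
    X.card ≤ (NQ ((Icc 1 (N + 4)).erase 1) (c + 2) (Hit M) X).card := by
  have hmn := hall_min hN hM hmin hY hY1 hYc
  set V := (Icc 1 (N + 4)).erase 1 with hV
  have hVc : V.card = N + 3 := by simp [hV]
  have hYV : Y ⊆ V := by
    intro y hy
    have h := hY hy
    rw [famInter, mem_filter] at h
    exact mem_erase.2 ⟨fun e => hY1 (e ▸ hy), h.1⟩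
  have hYS : ∀ y ∈ Y, ∀ B, Hit M (insert y B) := by
    intro y hy B S hS
    have h := hY hy
    rw [famInter, mem_filter] at h
    exact ⟨y, mem_inter.2 ⟨by simp, h.2 S hS⟩⟩
  obtain ⟨y1, y2, y3, h12, h13, h23, rfl⟩ := card_eq_three.1 hYc
  have m1 : y1 ∈ V := hYV (by simp)
  have m2 : y2 ∈ V.erase y1 := mem_erase.2 ⟨h12.symm, hYV (by simp)⟩
  have m3 : y3 ∈ (V.erase y1).erase y2 :=
    mem_erase.2 ⟨h23.symm, mem_erase.2 ⟨h13.symm, hYV (by simp)⟩⟩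
  have k1 : (V.erase y1).card = N + 2 := by rw [card_erase_of_mem m1]; omega
  have k2 : ((V.erase y1).erase y2).card = N + 1 := by rw [card_erase_of_mem m2]; omega
  have k3 : (((V.erase y1).erase y2).erase y3).card = N := by rw [card_erase_of_mem m3]; omega
  have p5 := choose_mono_fact N c hN
  have hsym : N.choose (N - (c + 1)) = N.choose (c + 1) := Nat.choose_symm (by omega)
  apply hall_split V (c + 1) y1 m1
  · apply hall_kk _ (c + 3) (c + 1) N _ (del_subset hX) _ (fun B => hYS y1 (by simp) B)
      (by omega) (by omega)
    have := card_filter_le X (fun A => y1 ∉ A)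
    rw [k1, show N + 2 - (c + 3) = N - (c + 1) by omega]
    omega
  have hX1 : lk y1 X ⊆ powersetCard (c + 2) (V.erase y1) := lk_subset hX
  have c1 := card_lk_add y1 X
  apply hall_split _ (c + 1) y2 m2
  · apply hall_kk _ (c + 2) (c + 1) N _ (del_subset hX1) _ (fun B => hYS y2 (by simp) B)
      (by omega) (by omega)
    have := card_filter_le (lk y1 X) (fun A => y2 ∉ A)
    rw [k2, show N + 1 - (c + 2) = N - (c + 1) by omega]
    omega
  have hX2 : lk y2 (lk y1 X) ⊆ powersetCard (c + 1) ((V.erase y1).erase y2) := lk_subset hX1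
  apply hall_split _ (c + 1) y3 m3
  · apply hall_deg _ (c + 1) (c + 1) _ _ (del_subset hX2) (by omega)
    intro A _
    exact ⟨∅, by simp, by simp, fun B _ _ _ => hYS y3 (by simp) B⟩
  have hX3 : lk y3 (lk y2 (lk y1 X)) ⊆ powersetCard c (((V.erase y1).erase y2).erase y3) :=
    lk_subset hX2
  have hVY : V \ {y1, y2, y3} = ((V.erase y1).erase y2).erase y3 := by
    ext x
    simp only [mem_sdiff, mem_insert, mem_singleton, mem_erase]
    tauto
  rw [hVY] at hmn
  apply hmn _ hX3
  intro A hA hAM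
  simp only [mem_lk] at hA
  apply hXM _ hA.2.2.2
  have : insert y1 (insert y2 (insert y3 A)) = A ∪ {y1, y2, y3} := by
    ext x
    simp only [mem_insert, mem_union, mem_singleton]
    tauto
  rw [this]
  exact hAM

lemma card_maxExt {N c : ℕ} {M : Finset (Finset ℕ)}
    (hM : M ⊆ powersetCard (c + 3) ((Icc 1 (N + 4)).erase 1)) (T : Finset (Finset ℕ))
    (hT : ∀ B ∈ T, B ∈ powersetCard (c + 2) ((Icc 1 (N + 4)).erase 1) ∧ Hit M B) :
    M.card + T.card ≤ (maxExt (N + 4) (c + 3) M).card := by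
  rw [card_lk_add 1 (maxExt (N + 4) (c + 3) M)]
  apply add_le_add <;> apply card_le_card
  · intro S hS
    have := mem_powersetCard.1 (hM hS)
    rw [mem_filter, maxExt, mem_union]
    exact ⟨Or.inl hS, fun h => by simpa using this.1 h⟩
  · intro B hB
    obtain ⟨h1, h2⟩ := hT B hB
    rw [mem_powersetCard] at h1
    have h3 : 1 ∉ B := fun h => by simpa using h1.1 h
    rw [mem_lk, maxExt, mem_union, mem_filter, mem_powersetCard]
    refine ⟨h3, Or.inr ⟨⟨?_, ?_⟩, by simp, ?_⟩⟩
    · apply insert_subset (by simp)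
      exact h1.1.trans (erase_subset _ _)
    · rw [card_insert_of_notMem h3]
      omega
    · intro S hS
      obtain ⟨x, hx⟩ := h2 S hS
      rw [mem_inter] at hx
      exact ⟨x, mem_inter.2 ⟨mem_insert_of_mem hx.1, hx.2⟩⟩

lemma assemble {N c : ℕ} (hN : 2 * c + 3 ≤ N) {M : Finset (Finset ℕ)} {Y : Finset ℕ}
    (hmin : MinimalWrtCommonInt (N + 4) M) (hY : Y ⊆ famInter (N + 4) M) (hY1 : 1 ∉ Y)
    (hYc : Y.card = 3) (W G : Finset (Finset ℕ))
    (hW : W ⊆ powersetCard (c + 3) ((Icc 1 (N + 4)).erase 1))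
    (hG : G ⊆ powersetCard (c + 2) ((Icc 1 (N + 4)).erase 1))
    (hWG : ∀ A ∈ W, ∀ B ∈ G, ¬ Disjoint A B) (hMW : M ⊆ W) (hWc : W.card ≤ N.choose c) :
    W.card + G.card ≤ (maxExt (N + 4) (c + 3) M).card := by
  have hM := hMW.trans hW
  have h1 := hall_full hN hM hmin hY hY1 hYc (W \ M) (sdiff_subset.trans hW)
    (fun A hA => (mem_sdiff.1 hA).2) ((card_le_card sdiff_subset).trans hWc)
  have h2 : (G ∪ NQ ((Icc 1 (N + 4)).erase 1) (c + 2) (Hit M) (W \ M)).card =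
      G.card + (NQ ((Icc 1 (N + 4)).erase 1) (c + 2) (Hit M) (W \ M)).card := by
    apply card_union_of_disjoint
    rw [disjoint_left]
    intro B hB hB2
    rw [mem_NQ] at hB2
    obtain ⟨_, _, A, hA, hd⟩ := hB2
    exact hWG A (mem_sdiff.1 hA).1 B hB hd
  have h3 := card_maxExt hM (G ∪ NQ ((Icc 1 (N + 4)).erase 1) (c + 2) (Hit M) (W \ M)) (by
    intro B hB
    rcases mem_union.1 hB with h | h
    · refine ⟨hG h, fun S hS => ?_⟩
      have := hWG S (hMW hS) B h
      rw [not_disjoint_iff_nonempty_inter, inter_comm] at this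
      exact this
    · rw [mem_NQ] at h
      exact ⟨mem_powersetCard.2 h.1, h.2.1⟩)
  have h4 := card_sdiff_add_card_eq_card hMW
  omega

lemma e3_le {N c : ℕ} (hN : 2 * c + 3 ≤ N) {M : Finset (Finset ℕ)} {Y : Finset ℕ}
    (hM : M ⊆ powersetCard (c + 3) ((Icc 1 (N + 4)).erase 1))
    (hmin : MinimalWrtCommonInt (N + 4) M) (hY : Y ⊆ famInter (N + 4) M) (hY1 : 1 ∉ Y)
    (hYc : Y.card = 3) :
    (N + 3).choose (c + 2) + N.choose c ≤ (maxExt (N + 4) (c + 3) M).card + N.choose (c + 2) := by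
  have key := assemble hN hmin hY hY1 hYc
  set V := (Icc 1 (N + 4)).erase 1 with hV
  have hVc : V.card = N + 3 := by simp [hV]
  have hYV : Y ⊆ V := by
    intro y hy
    have h := hY hy
    rw [famInter, mem_filter] at h
    exact mem_erase.2 ⟨fun e => hY1 (e ▸ hy), h.1⟩
  have hUc : (V \ Y).card = N := by
    rw [card_sdiff_of_subset hYV]
    omega
  have hWc : ((powersetCard c (V \ Y)).image (fun A => A ∪ Y)).card = N.choose c := by
    rw [card_image_of_injOn, card_powersetCard, hUc]
    intro A hA B hB e
    rw [mem_coe, mem_powersetCard] at hA hB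
    have dA : Disjoint A Y := (subset_sdiff.1 hA.1).2
    have dB : Disjoint B Y := (subset_sdiff.1 hB.1).2
    have e' : A ∪ Y = B ∪ Y := e
    rw [← union_sdiff_cancel_right dA, e', union_sdiff_cancel_right dB]
  have h := key ((powersetCard c (V \ Y)).image (fun A => A ∪ Y))
    (powersetCard (c + 2) V \ powersetCard (c + 2) (V \ Y)) ?_ sdiff_subset ?_ ?_ hWc.le
  · rw [hWc, card_sdiff_of_subset (powersetCard_mono sdiff_subset), card_powersetCard,
      card_powersetCard, hUc, hVc] at h
    have : N.choose (c + 2) ≤ (N + 3).choose (c + 2) := Nat.choose_le_choose _ (by omega)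
    omega
  · intro S hS
    obtain ⟨A, hA, rfl⟩ := mem_image.1 hS
    rw [mem_powersetCard] at hA
    rw [mem_powersetCard, card_union_of_disjoint (subset_sdiff.1 hA.1).2]
    exact ⟨union_subset (hA.1.trans sdiff_subset) hYV, by omega⟩
  · intro S hS B hB hd
    obtain ⟨A, hA, rfl⟩ := mem_image.1 hS
    simp only [mem_sdiff, mem_powersetCard, not_and] at hB
    refine hB.2 (subset_sdiff.2 ⟨hB.1.1, ?_⟩) hB.1.2
    exact (disjoint_union_left.1 hd).2.symm
  · intro S hS
    have hSc := mem_powersetCard.1 (hM hS)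
    have hYS : Y ⊆ S := by
      intro y hy
      have h := hY hy
      rw [famInter, mem_filter] at h
      exact h.2 S hS
    rw [mem_image]
    refine ⟨S \ Y, ?_, sdiff_union_of_subset hYS⟩
    rw [mem_powersetCard, card_sdiff_of_subset hYS]
    exact ⟨sdiff_subset_sdiff hSc.1 le_rfl, by omega⟩

lemma exists_Y {N c : ℕ} (hN : 2 * c + 3 ≤ N) {M : Finset (Finset ℕ)}
    (hM : M ⊆ powersetCard (c + 3) ((Icc 1 (N + 4)).erase 1))
    (ht : 3 ≤ (famInter (N + 4) M).card) :
    ∃ Y ⊆ famInter (N + 4) M, 1 ∉ Y ∧ Y.card = 3 := by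
  have h : 3 ≤ ((famInter (N + 4) M).erase 1).card := by
    by_cases h1 : 1 ∈ famInter (N + 4) M
    · have hMe : M = ∅ := by
        by_contra hne
        obtain ⟨S, hS⟩ := nonempty_iff_ne_empty.2 hne
        have h2 := (mem_filter.1 h1).2 S hS
        have := (mem_powersetCard.1 (hM hS)).1 h2
        simp at this
      rw [card_erase_of_mem h1]
      subst hMe
      simp [famInter]
    · rw [erase_eq_of_notMem h1]
      exact ht
  obtain ⟨Y, hY, hYc⟩ := exists_subset_card_eq h
  refine ⟨Y, hY.trans (erase_subset _ _), fun h => by simpa using hY h, hYc⟩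

end Part7

theorem stmt4 (n k t : ℕ) (hk : 8 ≤ 2 * k) (hn : 2 * k < n)
    (F : Finset (Finset ℕ)) (hF : F ⊆ Finset.powersetCard k (Finset.Icc 1 n))
    (hint : Intersecting F)
    (hdiv : diversity n F = (F.filter (fun A => 1 ∉ A)).card)
    (M : Finset (Finset ℕ)) (hM : M ⊆ F.filter (fun A => 1 ∉ A))
    (hmin : MinimalWrtCommonInt n M)
    (htM : (famInter n M).card = t) (ht : 3 ≤ t) :
    F.card ≤ (maxExt n k M).card := by
  obtain ⟨c, rfl⟩ : ∃ c, k = c + 3 := ⟨k - 3, by omega⟩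
  obtain ⟨N, rfl⟩ : ∃ N, n = N + 4 := ⟨n - 4, by omega⟩
  have hN : 2 * c + 3 ≤ N := by omega
  have hM' := hM.trans (del_subset hF)
  obtain ⟨Y, hY, hY1, hYc⟩ := exists_Y hN hM' (by omega)
  have he := e3_le hN hM' hmin hY hY1 hYc
  by_cases hbig : (N + 3).choose (c + 2) + N.choose c < F.card + N.choose (c + 2)
  · by_cases hd : N.choose c ≤ (F.filter (fun A => 1 ∉ A)).card
    · exfalso
      refine no_bad hN (F := F) ⟨hF, hint, hbig, ?_⟩
      intro i hi
      refine hd.trans ?_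
      rw [← hdiv, diversity]
      exact Nat.sInf_le ⟨i, by simpa using hi, rfl⟩
    · rw [card_lk_add 1 F]
      refine assemble hN hmin hY hY1 hYc _ _ (del_subset hF) (lk_subset hF) ?_ hM (by omega)
      intro A hA B hB hAB
      rw [Finset.mem_filter] at hA
      rw [mem_lk] at hB
      refine inter_not_disjoint hint hA.1 hB.2 ?_
      rw [Finset.disjoint_insert_right]
      exact ⟨hA.2, hAB⟩
  · omega
end
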